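/- arXiv:1901.11141 — 10 statements merged into one kernel-verified Lean document; each statement's English description precedes it below -/
import Mathlib

section
/- Fix M ≥ 2, k ∈ {1,…,M−1}, and η ∈ Δ_M. For every s ∈ ℝ^M and every top-k selector r_k, the conditional top-k risk satisfies L_{err_k}(s,η) = Σ_{m ∉ r_k(s)} η_m ≥ 1 − Σ_{j=1}^k η_{[j]}. Moreover, equality L_{err_k}(s,η) = 1 − Σ_{j=1}^k η_{[j]} holds for every top-k selector r_k if and only if s is top-k preserving with respect to η. -/
open scoped BigOperators
open Classical in
noncomputable def kthLargestList (l : List ℝ) (j : ℕ) : ℝ :=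
  (List.insertionSort (· ≥ ·) l).getD (j - 1) 0

noncomputable def kthLargest {M : ℕ} (v : Fin M → ℝ) (j : ℕ) : ℝ :=
  kthLargestList (List.ofFn v) j

noncomputable def kthLargestExcept {M : ℕ} (s : Fin M → ℝ) (y : Fin M) (j : ℕ) : ℝ :=
  kthLargestList ((List.ofFn s).eraseIdx y.val) j

def Simplex (M : ℕ) : Set (Fin M → ℝ) := {v | (∀ m, 0 ≤ v m) ∧ ∑ m, v m = 1}

def TopkPreserving {M : ℕ} (k : ℕ) (y x : Fin M → ℝ) : Prop :=
  ∀ m : Fin M, (kthLargest x (k + 1) < x m → kthLargest y (k + 1) < y m) ∧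
    (x m < kthLargest x k → y m < kthLargest y k)

noncomputable def condRisk {M : ℕ} (ψ : (Fin M → ℝ) → Fin M → ℝ) (s η : Fin M → ℝ) : ℝ :=
  ∑ m, η m * ψ s m

def TopkCalibrated (M k : ℕ) (ψ : (Fin M → ℝ) → Fin M → ℝ) : Prop :=
  ∀ η ∈ Simplex M,
    sInf {L | ∃ s, ¬ TopkPreserving k s η ∧ L = condRisk ψ s η} >
    sInf {L | ∃ s, L = condRisk ψ s η}

def IsTopkSelector (M k : ℕ) (r : (Fin M → ℝ) → Finset (Fin M)) : Prop :=
  ∀ s, (r s).card = k ∧ ∀ i ∈ r s, ∀ j ∉ r s, s j ≤ s i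

lemma kth_sorted (M : ℕ) (v : Fin M → ℝ) : ∃ σ : Equiv.Perm (Fin M),
    Antitone (v ∘ σ) ∧ ∀ j : Fin M, kthLargest v (j.val + 1) = v (σ j) := by
  classical
  let σ := Tuple.sort (fun i => - v i)
  have hs : Antitone (v ∘ σ) := by
    intro a b hab
    have := Tuple.monotone_sort (fun i => - v i) hab
    simpa [σ] using this
  refine ⟨σ, hs, fun j => ?_⟩
  have h : List.insertionSort (· ≥ ·) (List.ofFn v) = List.ofFn (v ∘ σ) := by
    apply List.Perm.eq_of_pairwise (le := (· ≥ ·))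
    · intro a b _ _ h1 h2
      exact le_antisymm h2 h1
    · exact List.pairwise_insertionSort _ _
    · rw [List.pairwise_ofFn]
      intro a b hab
      exact hs hab.le
    · exact (List.perm_insertionSort _ _).trans (Equiv.Perm.ofFn_comp_perm σ v).symm
  unfold kthLargest kthLargestList
  have h' : (@List.insertionSort ℝ (· ≥ ·) (fun a b => Classical.propDecidable _) (List.ofFn v)) = List.ofFn (v ∘ σ) := by
    rw [← h]
  rw [h']
  simp [List.getD]

def TopKSet {M : ℕ} (k : ℕ) (v : Fin M → ℝ) (T : Finset (Fin M)) : Prop :=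
  T.card = k ∧ ∀ i ∈ T, ∀ j ∉ T, v j ≤ v i

lemma base_top (M k : ℕ) (hk1 : 1 ≤ k) (hkM : k < M) (v : Fin M → ℝ) :
    ∃ (T : Finset (Fin M)) (p q : Fin M), T.card = k ∧ p ∈ T ∧ q ∉ T ∧
      kthLargest v k = v p ∧ kthLargest v (k + 1) = v q ∧ (∀ i ∈ T, v p ≤ v i) ∧
      (∀ j ∉ T, v j ≤ v q) ∧ v q ≤ v p ∧
      ∑ j ∈ Finset.Icc 1 k, kthLargest v j = ∑ i ∈ T, v i := by
  obtain ⟨σ, hs, hσ⟩ := kth_sorted M v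
  let e : Fin k ↪ Fin M := (Fin.castLEEmb hkM.le).trans σ.toEmbedding
  have he : ∀ a : Fin k, e a = σ ⟨a, a.2.trans hkM⟩ := fun a => rfl
  have hmem : ∀ a : Fin M, σ a ∈ Finset.univ.map e ↔ a.val < k := by
    intro a
    simp only [Finset.mem_map, Finset.mem_univ, true_and, he, σ.injective.eq_iff]
    constructor
    · rintro ⟨b, rfl⟩; exact b.2
    · intro h; exact ⟨⟨a, h⟩, rfl⟩
  have hle : ∀ a b : Fin M, a.val ≤ b.val → v (σ b) ≤ v (σ a) := fun a b h => hs h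
  refine ⟨Finset.univ.map e, σ ⟨k - 1, by omega⟩, σ ⟨k, hkM⟩, by simp, ?_, ?_, ?_, ?_, ?_, ?_, ?_, ?_⟩
  · rw [hmem]; simp; omega
  · rw [hmem]; simp
  · rw [← hσ]; simp [Nat.sub_add_cancel hk1]
  · rw [← hσ]
  · intro i
    obtain ⟨a, rfl⟩ := σ.surjective i
    rw [hmem]; intro h; apply hle; simp; omega
  · intro i
    obtain ⟨a, rfl⟩ := σ.surjective i
    rw [hmem]; intro h; apply hle; simp; omega
  · apply hle; simp
  · rw [Finset.sum_map, ← Finset.Ico_add_one_right_eq_Icc, Finset.sum_Ico_eq_sum_range, Nat.add_sub_cancel,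
      ← Fin.sum_univ_eq_sum_range (fun i => kthLargest v (1 + i)) k]
    refine Finset.sum_congr rfl fun a _ => ?_
    rw [he, ← hσ, add_comm]

lemma thr_sum {M : ℕ} (v : Fin M → ℝ) (c : ℝ) (T : Finset (Fin M)) :
    ∑ i, max (v i - c) 0 = (∑ i ∈ T, v i - T.card * c) +
      ((∑ i ∈ T, max (c - v i) 0) + ∑ i ∈ Tᶜ, max (v i - c) 0) := by
  rw [← Finset.sum_add_sum_compl T, ← nsmul_eq_mul, ← Finset.sum_const, ← Finset.sum_sub_distrib,
    ← add_assoc, ← Finset.sum_add_distrib]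
  congr 1
  refine Finset.sum_congr rfl fun i _ => ?_
  rcases le_total (v i) c with h | h
  · rw [max_eq_right (by linarith), max_eq_left (by linarith)]; ring
  · rw [max_eq_left (by linarith), max_eq_right (by linarith)]; ring

lemma thr_eq {M : ℕ} (v : Fin M → ℝ) (c : ℝ) (T : Finset (Fin M))
    (h1 : ∀ i ∈ T, c ≤ v i) (h2 : ∀ i ∉ T, v i ≤ c) :
    ∑ i, max (v i - c) 0 = ∑ i ∈ T, v i - T.card * c := by
  have z1 : ∑ i ∈ T, max (c - v i) 0 = 0 :=
    Finset.sum_eq_zero fun i hi => max_eq_right (by linarith [h1 i hi])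
  have z2 : ∑ i ∈ Tᶜ, max (v i - c) 0 = 0 :=
    Finset.sum_eq_zero fun i hi => max_eq_right (by linarith [h2 i (by simpa using hi)])
  rw [thr_sum v c T, z1, z2]
  ring

lemma sum_nn1 {M : ℕ} (v : Fin M → ℝ) (c : ℝ) (T : Finset (Fin M)) :
    0 ≤ ∑ i ∈ T, max (c - v i) 0 := Finset.sum_nonneg fun _ _ => le_max_right _ _

lemma sum_nn2 {M : ℕ} (v : Fin M → ℝ) (c : ℝ) (T : Finset (Fin M)) :
    0 ≤ ∑ i ∈ T, max (v i - c) 0 := Finset.sum_nonneg fun _ _ => le_max_right _ _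

lemma sum_le_kth {M k : ℕ} (hk1 : 1 ≤ k) (hkM : k < M) (v : Fin M → ℝ) (T : Finset (Fin M))
    (hT : T.card = k) :
    ∑ i ∈ T, v i ≤ ∑ j ∈ Finset.Icc 1 k, kthLargest v j := by
  obtain ⟨T0, p, q, hc, hp, hq, -, -, h1, h2, h3, hs⟩ := base_top M k hk1 hkM v
  have e1 := thr_eq v (v p) T0 h1 (fun i hi => (h2 i hi).trans h3)
  have e2 := thr_sum v (v p) T
  rw [hs]
  rw [hT] at e2; rw [hc] at e1
  linarith [sum_nn1 v (v p) T, sum_nn2 v (v p) Tᶜ]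

lemma sum_eq_kth {M k : ℕ} (hk1 : 1 ≤ k) (hkM : k < M) (v : Fin M → ℝ) (T : Finset (Fin M))
    (hT : T.card = k) :
    ∑ i ∈ T, v i = ∑ j ∈ Finset.Icc 1 k, kthLargest v j ↔ TopKSet k v T := by
  constructor
  · obtain ⟨T0, p, q, hc, hp, hq, -, -, h1, h2, h3, hs⟩ := base_top M k hk1 hkM v
    have e1 := thr_eq v (v p) T0 h1 (fun i hi => (h2 i hi).trans h3)
    have e2 := thr_sum v (v p) T
    rw [hs]
    rw [hT] at e2; rw [hc] at e1
    intro h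
    have n1 := sum_nn1 v (v p) T
    have n2 := sum_nn2 v (v p) Tᶜ
    have z1 : ∑ i ∈ T, max (v p - v i) 0 = 0 := by linarith
    have z2 : ∑ i ∈ Tᶜ, max (v i - v p) 0 = 0 := by linarith
    rw [Finset.sum_eq_zero_iff_of_nonneg (fun _ _ => le_max_right _ _)] at z1 z2
    refine ⟨hT, fun i hi j hj => ?_⟩
    have a := z1 i hi
    have b := z2 j (by simpa using hj)
    have := le_max_left (v p - v i) 0
    have := le_max_left (v j - v p) 0
    linarith
  · intro h
    apply le_antisymm (sum_le_kth hk1 hkM v T hT)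
    obtain ⟨T0, p, q, hc, hp, hq, -, -, h1, h2, h3, hs⟩ := base_top M k hk1 hkM v
    rw [hs]
    obtain ⟨t, ht, hmin⟩ := Finset.exists_min_image T v (Finset.card_pos.1 (by omega))
    have e1 := thr_eq v (v t) T hmin (fun i hi => h.2 t ht i hi)
    have e2 := thr_sum v (v t) T0
    rw [hT] at e1; rw [hc] at e2
    linarith [sum_nn1 v (v t) T0, sum_nn2 v (v t) T0ᶜ]

lemma must_in {M k : ℕ} (hk1 : 1 ≤ k) (hkM : k < M) (v : Fin M → ℝ) (m : Fin M) :
    kthLargest v (k + 1) < v m ↔ ∀ T, TopKSet k v T → m ∈ T := by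
  obtain ⟨T0, p, q, hc, hp, hq, -, e, h1, h2, h3, -⟩ := base_top M k hk1 hkM v
  rw [e]
  constructor
  · intro h T hT
    by_contra hm
    have hsub : insert m T ⊆ T0 := by
      intro i hi
      by_contra hn
      have := h2 i hn
      rcases Finset.mem_insert.1 hi with rfl | hi
      · linarith
      · linarith [hT.2 i hi m hm]
    have := Finset.card_le_card hsub
    rw [Finset.card_insert_of_notMem hm, hT.1, hc] at this
    omega
  · intro h
    by_contra hn
    push Not at hn
    have hm : m ∈ T0 := h T0 ⟨hc, fun i hi j hj => by linarith [h1 i hi, h2 j hj]⟩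
    have := h (insert q (T0.erase m)) ⟨by
      rw [Finset.card_insert_of_notMem (by simp [hq]), Finset.card_erase_of_mem hm]; omega, by
      intro i hi j hj
      trans v q
      · by_cases hj0 : j ∈ T0
        · have : j = m := by
            by_contra hne
            exact hj (by simp [hne, hj0])
          rw [this]; exact hn
        · exact h2 j hj0
      · rcases Finset.mem_insert.1 hi with rfl | hi
        · exact le_rfl
        · exact h3.trans (h1 i (Finset.mem_of_mem_erase hi))⟩
    have hne : m ≠ q := fun h => hq (h ▸ hm)
    simp [hne] at this

lemma must_out {M k : ℕ} (hk1 : 1 ≤ k) (hkM : k < M) (v : Fin M → ℝ) (m : Fin M) :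
    v m < kthLargest v k ↔ ∀ T, TopKSet k v T → m ∉ T := by
  obtain ⟨T0, p, q, hc, hp, hq, e, -, h1, h2, h3, -⟩ := base_top M k hk1 hkM v
  rw [e]
  constructor
  · intro h T hT hm
    have hsub : T0 ⊆ T.erase m := by
      intro i hi
      have := h1 i hi
      rw [Finset.mem_erase]
      refine ⟨by rintro rfl; linarith, ?_⟩
      by_contra hn
      linarith [hT.2 m hm i hn]
    have := Finset.card_le_card hsub
    rw [Finset.card_erase_of_mem hm, hT.1, hc] at this
    omega
  · intro h
    by_contra hn
    push Not at hn
    have hm : m ∉ T0 := h T0 ⟨hc, fun i hi j hj => by linarith [h1 i hi, h2 j hj]⟩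
    refine h (insert m (T0.erase p)) ⟨by
      rw [Finset.card_insert_of_notMem (by simp [hm]), Finset.card_erase_of_mem hp]; omega, ?_⟩
      (by simp)
    intro i hi j hj
    trans v p
    · by_cases hj0 : j ∈ T0
      · have : j = p := by
          by_contra hne
          exact hj (by simp [hne, hj0])
        rw [this]
      · exact (h2 j hj0).trans h3
    · rcases Finset.mem_insert.1 hi with rfl | hi
      · exact hn
      · exact h1 i (Finset.mem_of_mem_erase hi)

theorem stmt0 (M k : ℕ) (hM : 2 ≤ M) (hk1 : 1 ≤ k) (hkM : k ≤ M - 1)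
    (η : Fin M → ℝ) (hη : η ∈ Simplex M) (s : Fin M → ℝ) :
    (∀ r : (Fin M → ℝ) → Finset (Fin M), IsTopkSelector M k r →
        1 - ∑ j ∈ Finset.Icc 1 k, kthLargest η j ≤ ∑ m ∈ (r s)ᶜ, η m) ∧
    ((∀ r : (Fin M → ℝ) → Finset (Fin M), IsTopkSelector M k r →
        ∑ m ∈ (r s)ᶜ, η m = 1 - ∑ j ∈ Finset.Icc 1 k, kthLargest η j) ↔
      TopkPreserving k s η) := by
  have hkM' : k < M := by omega
  have hrisk : ∀ T : Finset (Fin M), ∑ m ∈ Tᶜ, η m = 1 - ∑ m ∈ T, η m := by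
    intro T
    have := Finset.sum_add_sum_compl T η
    rw [hη.2] at this
    linarith
  refine ⟨fun r hr => ?_, ?_⟩
  · rw [hrisk]
    linarith [sum_le_kth hk1 hkM' η (r s) (hr s).1]
  have key : (∀ r : (Fin M → ℝ) → Finset (Fin M), IsTopkSelector M k r →
        ∑ m ∈ (r s)ᶜ, η m = 1 - ∑ j ∈ Finset.Icc 1 k, kthLargest η j) ↔
      ∀ T, TopKSet k s T → TopKSet k η T := by
    constructor
    · intro h T hT
      have hex : ∀ v : Fin M → ℝ, ∃ T, TopKSet k v T := by
        intro v
        obtain ⟨T0, p, q, hc, hp, hq, -, -, h1, h2, h3, -⟩ := base_top M k hk1 hkM' v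
        exact ⟨T0, hc, fun i hi j hj => by linarith [h1 i hi, h2 j hj]⟩
      choose f hf using hex
      classical
      have := h (Function.update f s T) (by
        intro v
        by_cases hv : v = s
        · subst hv; rw [Function.update_self]; exact hT
        · rw [Function.update_of_ne hv]; exact hf v)
      rw [Function.update_self, hrisk] at this
      rw [← sum_eq_kth hk1 hkM' η T hT.1]
      linarith
    · intro h r hr
      have := (sum_eq_kth hk1 hkM' η (r s) (hr s).1).2 (h _ (hr s))
      rw [hrisk, this]
  rw [key]
  constructor
  · intro h m
    rw [must_in hk1 hkM', must_in hk1 hkM', must_out hk1 hkM', must_out hk1 hkM']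
    exact ⟨fun a T hT => a T (h T hT), fun a T hT => a T (h T hT)⟩
  · intro h T hT
    obtain ⟨T0, p, q, hc, hp, hq, e1, e2, h1, h2, h3, -⟩ := base_top M k hk1 hkM' η
    refine ⟨hT.1, fun i hi j hj => ?_⟩
    have a : ¬ η i < kthLargest η k := fun a =>
      (must_out hk1 hkM' s i).1 ((h i).2 a) T hT hi
    have b : ¬ kthLargest η (k + 1) < η j := fun b =>
      hj ((must_in hk1 hkM' s j).1 ((h j).1 b) T hT)
    rw [e1] at a; rw [e2] at b
    linarith
end

section
/- Let ψ : ℝ^M × {1,…,M} → [0,∞) be a nonnegative loss function. Then the optimal conditional risk function L_ψ* : Δ_M → ℝ defined by L_ψ*(η) = inf_{s ∈ ℝ^M} Σ_{m=1}^M η_m ψ(s,m) is continuous on Δ_M. -/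
open scoped BigOperators
theorem stmt3 (M : ℕ) (hM : 2 ≤ M)
    (ψ : (Fin M → ℝ) → Fin M → ℝ) (hψ : ∀ s y, 0 ≤ ψ s y) :
    ContinuousOn (fun η : Fin M → ℝ => sInf {L : ℝ | ∃ s : Fin M → ℝ, L = ∑ m, η m * ψ s m})
      (Simplex M) := by
  have hbdd : ∀ η ∈ Simplex M, BddBelow {L : ℝ | ∃ s : Fin M → ℝ, L = ∑ m, η m * ψ s m} := by
    intro η hη
    refine ⟨0, ?_⟩
    rintro L ⟨s, rfl⟩
    exact Finset.sum_nonneg fun m _ => mul_nonneg (hη.1 m) (hψ s m)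
  have hne : ∀ η : Fin M → ℝ, {L : ℝ | ∃ s : Fin M → ℝ, L = ∑ m, η m * ψ s m}.Nonempty :=
    fun η => ⟨_, 0, rfl⟩
  intro η₀ hη₀
  refine tendsto_order.2 ⟨fun a ha => ?_, fun a ha => ?_⟩
  · set F := sInf {L : ℝ | ∃ s : Fin M → ℝ, L = ∑ m, η₀ m * ψ s m} with hF
    have h1 : ∀ᶠ c : ℝ in nhdsWithin 1 (Set.Iio 1), a < c * F := by
      have : Filter.Tendsto (fun c : ℝ => c * F) (nhds 1) (nhds (1 * F)) :=
        (continuous_id.mul continuous_const).tendsto 1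
      rw [one_mul] at this
      exact (this.eventually (lt_mem_nhds ha)).filter_mono nhdsWithin_le_nhds
    have h2 : ∀ᶠ c : ℝ in nhdsWithin 1 (Set.Iio 1), 0 < c :=
      (lt_mem_nhds one_pos).filter_mono nhdsWithin_le_nhds
    obtain ⟨c, ⟨hcF, hc0⟩, hc1⟩ := ((h1.and h2).and self_mem_nhdsWithin).exists
    have hc1 : c < 1 := hc1
    have hev : ∀ᶠ η in nhdsWithin η₀ (Simplex M), ∀ m, c * η₀ m ≤ η m := by
      rw [Filter.eventually_all]
      intro m
      rcases (hη₀.1 m).eq_or_lt with h | h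
      · filter_upwards [self_mem_nhdsWithin] with η hη
        rw [← h, mul_zero]
        exact hη.1 m
      · have hlt : c * η₀ m < η₀ m := by nlinarith
        have := ((continuous_apply m).tendsto η₀).eventually (lt_mem_nhds hlt)
        exact (this.filter_mono nhdsWithin_le_nhds).mono fun η h => h.le
    filter_upwards [hev] with η hη
    refine hcF.trans_le (le_csInf (hne η) ?_)
    rintro L ⟨s, rfl⟩
    calc c * F ≤ c * ∑ m, η₀ m * ψ s m :=
          mul_le_mul_of_nonneg_left (csInf_le (hbdd η₀ hη₀) ⟨s, rfl⟩) hc0.le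
      _ = ∑ m, c * η₀ m * ψ s m := by simp only [Finset.mul_sum, mul_assoc]
      _ ≤ _ := Finset.sum_le_sum fun m _ => mul_le_mul_of_nonneg_right (hη m) (hψ s m)
  · obtain ⟨L, ⟨s, rfl⟩, hs⟩ := exists_lt_of_csInf_lt (hne η₀) ha
    have hcont : Continuous fun η : Fin M → ℝ => ∑ m, η m * ψ s m := by fun_prop
    have := (hcont.tendsto η₀).eventually (gt_mem_nhds hs)
    filter_upwards [this.filter_mono nhdsWithin_le_nhds, self_mem_nhdsWithin] with η h hη
    exact (csInf_le (hbdd η hη) ⟨s, rfl⟩).trans_lt h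
end

section
/- For every η ∈ ℝ^M and every k ∈ {1,…,M−1}, the set P_k(η) := {s ∈ ℝ^M : s is top-k preserving with respect to η} is an open subset of ℝ^M. -/
open scoped BigOperators
theorem kthLargest_eq_of_antitone {M : ℕ} (v : Fin M → ℝ) (σ : Equiv.Perm (Fin M))
    (h : Antitone (v ∘ σ)) (j : ℕ) (hj : j - 1 < M) :
    kthLargest v j = v (σ ⟨j - 1, hj⟩) := by
  classical
  have e : List.insertionSort (· ≥ ·) (List.ofFn v) = List.ofFn (v ∘ σ) :=
    ((List.perm_insertionSort _ _).trans (σ.ofFn_comp_perm v).symm).eq_of_pairwise'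
      (List.pairwise_insertionSort (· ≥ ·) _) h.sortedGE_ofFn.pairwise
  unfold kthLargest kthLargestList
  have e2 : (List.ofFn (v ∘ σ)).getD (j - 1) 0 = v (σ ⟨j - 1, hj⟩) := by
    simp [List.getD, hj]
  rw [← e2, ← e]

theorem exists_perm_antitone {M : ℕ} (v : Fin M → ℝ) :
    ∃ σ : Equiv.Perm (Fin M), Antitone (v ∘ σ) := by
  refine ⟨Tuple.sort (fun i => - v i), fun i j hij => ?_⟩
  have := Tuple.monotone_sort (fun i => - v i) hij
  simpa using this

theorem continuous_kthLargest {M : ℕ} (j : ℕ) (hj : j - 1 < M) :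
    Continuous (fun v : Fin M → ℝ => kthLargest v j) := by
  refine LocallyFinite.continuous
    (f := fun σ : Equiv.Perm (Fin M) => {v : Fin M → ℝ | Antitone (v ∘ σ)})
    (locallyFinite_of_finite _) ?_ ?_ ?_
  · ext v
    simpa using exists_perm_antitone v
  · intro σ
    simp only [Antitone, Set.ofPred_forall]
    refine isClosed_iInter fun a => isClosed_iInter fun b => isClosed_iInter fun _ => ?_
    exact isClosed_le (continuous_apply _) (continuous_apply _)
  · intro σ
    exact (continuous_apply (σ ⟨j - 1, hj⟩)).continuousOn.congr
      fun v hv => kthLargest_eq_of_antitone v σ hv j hj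

theorem stmt4 (M k : ℕ) (hM : 2 ≤ M) (hk1 : 1 ≤ k) (hkM : k ≤ M - 1)
    (η : Fin M → ℝ) :
    IsOpen {s : Fin M → ℝ | TopkPreserving k s η} := by
  have c1 := continuous_kthLargest (M := M) (k + 1) (by omega)
  have c2 := continuous_kthLargest (M := M) k (by omega)
  simp only [TopkPreserving, Set.ofPred_forall, Set.ofPred_and]
  refine isOpen_iInter_of_finite fun m => IsOpen.inter ?_ ?_
  · exact isOpen_iInter_of_finite fun _ => isOpen_lt c1 (continuous_apply m)
  · exact isOpen_iInter_of_finite fun _ => isOpen_lt (continuous_apply m) c2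
end

section
/- Fix M ≥ 2, k ∈ {1,…,M−1}, and let η ∈ Δ_M satisfy η_1 ≥ η_2 ≥ … ≥ η_M. Consider the loss ψ1(s,y) := max{1 + (s_{∖y})_{[k]} − s_y, 0}. (i) If η_k ≥ Σ_{i=k+1}^M η_i, then the vector b ∈ ℝ^M with b_1 = … = b_k = 1 and b_{k+1} = … = b_M = 0 is a global minimizer of s ↦ L_{ψ1}(s,η), and the minimum value is 2 Σ_{i=k+1}^M η_i. (ii) If η_k ≤ Σ_{i=k+1}^M η_i, then the vector a ∈ ℝ^M with a_1 = … = a_{k−1} = 1 and a_k = … = a_M = 0 is a global minimizer of s ↦ L_{ψ1}(s,η), and the minimum value is Σ_{i=k}^M η_i. -/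
open scoped BigOperators
/-- `ψ1(s,y) = max{1 + (s_{∖y})_{[k]} − s_y, 0}` -/
noncomputable def psi1 {M : ℕ} (k : ℕ) (s : Fin M → ℝ) (y : Fin M) : ℝ :=
  max (1 + kthLargestExcept s y k - s y) 0

theorem kthList_ge (l : List ℝ) (j : ℕ) (t : ℝ) (hj : 1 ≤ j)
    (h : j ≤ l.countP (fun x => decide (t ≤ x))) : t ≤ kthLargestList l j := by
  classical
  unfold kthLargestList
  set L := List.insertionSort (· ≥ ·) l with hL
  have hp : L.Perm l := by rw [hL]; exact List.perm_insertionSort _ l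
  have hs : L.Pairwise (· ≥ ·) := by rw [hL]; exact List.pairwise_insertionSort _ l
  rw [← hp.countP_eq] at h
  have hlen : j - 1 < L.length := by
    have := List.countP_le_length (p := fun x => decide (t ≤ x)) (l := L)
    omega
  rw [List.getD_eq_getElem _ _ hlen]
  by_contra hlt
  push Not at hlt
  have h0 : (L.drop (j-1)).countP (fun x => decide (t ≤ x)) = 0 := by
    rw [List.countP_eq_zero]
    intro a ha
    obtain ⟨i, hi, rfl⟩ := List.mem_iff_getElem.1 ha
    rw [List.getElem_drop]
    have : L[j-1+i]'(by simp at hi; omega) ≤ L[j-1] := by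
      rcases Nat.eq_zero_or_pos i with rfl | hi0
      · simp
      · exact List.pairwise_iff_getElem.1 hs _ _ _ _ (by omega)
    simp only [decide_eq_true_eq, not_le]
    exact lt_of_le_of_lt this hlt
  rw [← List.take_append_drop (j-1) L, List.countP_append, h0] at h
  have := List.countP_le_length (p := fun x => decide (t ≤ x)) (l := L.take (j-1))
  simp only [List.length_take] at this
  omega

theorem kthList_le (l : List ℝ) (j : ℕ) (t : ℝ) (hj : 1 ≤ j) (hjl : j ≤ l.length)
    (h : l.length + 1 ≤ l.countP (fun x => decide (x ≤ t)) + j) : kthLargestList l j ≤ t := by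
  classical
  unfold kthLargestList
  set L := List.insertionSort (· ≥ ·) l with hL
  have hp : L.Perm l := by rw [hL]; exact List.perm_insertionSort _ l
  have hs : L.Pairwise (· ≥ ·) := by rw [hL]; exact List.pairwise_insertionSort _ l
  rw [← hp.countP_eq, ← hp.length_eq] at h
  rw [← hp.length_eq] at hjl
  have hlen : j - 1 < L.length := by omega
  rw [List.getD_eq_getElem _ _ hlen]
  by_contra hlt
  push Not at hlt
  have h0 : (L.take j).countP (fun x => decide (x ≤ t)) = 0 := by
    rw [List.countP_eq_zero]
    intro a ha
    obtain ⟨i, hi, rfl⟩ := List.mem_iff_getElem.1 ha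
    rw [List.getElem_take]
    have hi' : i < j := by simp at hi; omega
    have : L[j-1] ≤ L[i]'(by omega) := by
      rcases Nat.eq_or_lt_of_le (Nat.le_sub_one_of_lt hi') with rfl | hi0
      · simp
      · exact List.pairwise_iff_getElem.1 hs _ _ _ _ (by omega)
    simp only [decide_eq_true_eq, not_le]
    exact lt_of_lt_of_le hlt this
  have h1 := List.countP_append (p := fun x => decide (x ≤ t)) (l₁ := L.take j) (l₂ := L.drop j)
  rw [List.take_append_drop, h0] at h1
  have := List.countP_le_length (p := fun x => decide (x ≤ t)) (l := L.drop j)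
  simp only [List.length_drop] at this
  omega

theorem count_except {M : ℕ} (s : Fin M → ℝ) (y : Fin M) (p : ℝ → Bool) (S : Finset (Fin M))
    (hy : y ∉ S) (hS : ∀ m ∈ S, p (s m) = true) :
    S.card ≤ ((List.ofFn s).eraseIdx y.val).countP p := by
  have e : (List.ofFn s).eraseIdx y.val = ((List.finRange M).eraseIdx y.val).map s := by
    rw [List.ofFn_eq_map, List.eraseIdx_map]
  rw [e, List.countP_map, List.countP_eq_length_filter]
  have hsub : S ⊆ (((List.finRange M).eraseIdx y.val).filter (p ∘ s)).toFinset := by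
    intro m hm
    simp only [List.mem_toFinset, List.mem_filter, Function.comp]
    refine ⟨?_, hS m hm⟩
    have hne : m ≠ y := fun h => hy (h ▸ hm)
    rw [List.mem_eraseIdx_iff_getElem]
    refine ⟨m.val, by simp, ?_, by simp⟩
    exact fun h => hne (Fin.ext h)
  exact (Finset.card_le_card hsub).trans (List.toFinset_card_le _)

theorem except_ge {M : ℕ} (k : ℕ) (hk : 1 ≤ k) (s : Fin M → ℝ) (y : Fin M) (t : ℝ)
    (S : Finset (Fin M)) (hy : y ∉ S) (hc : k ≤ S.card) (hS : ∀ m ∈ S, t ≤ s m) :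
    t ≤ kthLargestExcept s y k :=
  kthList_ge _ _ _ hk (hc.trans (count_except s y _ S hy (by simpa using hS)))

theorem except_le {M : ℕ} (k : ℕ) (hk : 1 ≤ k) (hkM : k ≤ M - 1) (s : Fin M → ℝ) (y : Fin M)
    (t : ℝ) (S : Finset (Fin M)) (hy : y ∉ S) (hc : M ≤ S.card + k) (hS : ∀ m ∈ S, s m ≤ t) :
    kthLargestExcept s y k ≤ t := by
  have hl : ((List.ofFn s).eraseIdx y.val).length = M - 1 := by
    rw [List.length_eraseIdx_of_lt (by simp)]; simp
  have := count_except s y (fun x => decide (x ≤ t)) S hy (by simpa using hS)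
  have := y.2
  exact kthList_le _ _ _ hk (by omega) (by omega)

theorem tail_perm {M : ℕ} (k : ℕ) (η : Fin M → ℝ) (hsorted : ∀ i j : Fin M, i ≤ j → η j ≤ η i)
    (σ : Equiv.Perm (Fin M)) :
    ∑ i : Fin M, (if k ≤ (i : ℕ) then η i else 0) ≤
      ∑ i : Fin M, (if k ≤ (i : ℕ) then η (σ i) else 0) := by
  have hf : Monotone (fun i : Fin M => if k ≤ (i : ℕ) then (1 : ℝ) else 0) := by
    intro i j hij
    have : (i : ℕ) ≤ j := hij
    dsimp only
    split_ifs <;> first | omega | norm_num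
  have hg : Antitone η := fun i j h => hsorted i j h
  have := (hf.antivary hg).sum_mul_le_sum_mul_comp_perm (σ := σ)
  simpa using this

theorem card_lt {M : ℕ} (k : ℕ) (hk : k ≤ M) :
    (Finset.univ.filter (fun i : Fin M => (i : ℕ) < k)).card = k := by
  rw [Fin.card_filter_val_lt]; omega

theorem card_ge {M : ℕ} (k : ℕ) :
    (Finset.univ.filter (fun i : Fin M => k ≤ (i : ℕ))).card = M - k := by
  have h := Finset.card_filter_add_card_filter_not (s := (Finset.univ : Finset (Fin M)))
    (fun i : Fin M => (i : ℕ) < k)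
  rw [Fin.card_filter_val_lt] at h
  simp at h
  omega

theorem lower_bound (M k : ℕ) (hM : 2 ≤ M) (hk1 : 1 ≤ k) (hkM : k ≤ M - 1)
    (η : Fin M → ℝ) (hη : η ∈ Simplex M)
    (hsorted : ∀ i j : Fin M, i ≤ j → η j ≤ η i) (s : Fin M → ℝ) :
    min (2 * ∑ i : Fin M, (if k ≤ (i : ℕ) then η i else 0))
      (∑ i : Fin M, (if k - 1 ≤ (i : ℕ) then η i else 0)) ≤ condRisk (psi1 k) s η := by
  classical
  set σ := Tuple.sort (fun i => - s i) with hσ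
  have hmono : ∀ i j : Fin M, i ≤ j → s (σ j) ≤ s (σ i) := by
    intro i j hij
    have := Tuple.monotone_sort (fun i => - s i) hij
    simp only [Function.comp] at this
    rw [hσ]; linarith
  have hH := tail_perm k η hsorted σ
  have hE := tail_perm (k-1) η hsorted σ
  set a : Fin M := ⟨k - 1, by omega⟩ with ha
  set b : Fin M := ⟨k, by omega⟩ with hb
  set d := s (σ a) - s (σ b) with hd
  have hd0 : 0 ≤ d := sub_nonneg.2 (hmono a b (by simp [ha, hb]))
  have hEa : ∑ i : Fin M, (if k - 1 ≤ (i : ℕ) then η (σ i) else 0)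
      = η (σ a) + ∑ i : Fin M, (if k ≤ (i : ℕ) then η (σ i) else 0) := by
    have : ∀ i : Fin M, (if k - 1 ≤ (i : ℕ) then η (σ i) else 0)
      = (if i = a then η (σ i) else 0) + (if k ≤ (i : ℕ) then η (σ i) else 0) := by
      intro i
      have : i = a ↔ (i : ℕ) = k - 1 := by rw [Fin.ext_iff]
      simp only [this]
      split_ifs <;> first | omega | simp
    rw [Finset.sum_congr rfl (fun i _ => this i), Finset.sum_add_distrib]
    simp
  have hR : max (1 - d) 0 * η (σ a) + (1 + d) * ∑ i : Fin M, (if k ≤ (i : ℕ) then η (σ i) else 0)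
      ≤ condRisk (psi1 k) s η := by
    unfold condRisk
    rw [← Equiv.sum_comp σ (fun m => η m * psi1 k s m)]
    have e : max (1 - d) 0 * η (σ a) = ∑ i : Fin M, if i = a then max (1 - d) 0 * η (σ i) else 0 := by
      simp
    rw [e, Finset.mul_sum, ← Finset.sum_add_distrib]
    refine Finset.sum_le_sum fun i _ => ?_
    have hpos := hη.1 (σ i)
    have hψ0 : 0 ≤ psi1 k s (σ i) := le_max_right _ _
    by_cases hia : i = a
    · have : ¬ (k ≤ (i : ℕ)) := by rw [hia]; simp [ha]; omega
      rw [if_pos hia, if_neg this, mul_zero, add_zero, mul_comm]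
      refine mul_le_mul_of_nonneg_left (max_le_max ?_ le_rfl) hpos
      have := except_ge k hk1 s (σ i) (s (σ b))
        (((Finset.univ.filter (fun i : Fin M => (i : ℕ) < k + 1)).erase i).map σ.toEmbedding)
        (by simp) (by
          rw [Finset.card_map, Finset.card_erase_of_mem, card_lt _ (by omega)]
          · simp
          · simp [hia, ha])
        (by
          intro m hm
          simp only [Finset.mem_map, Finset.mem_erase, Finset.mem_filter, Finset.mem_univ,
            true_and] at hm
          obtain ⟨j, ⟨_, hj⟩, rfl⟩ := hm
          exact hmono j b (by rw [Fin.le_def]; simp [hb]; omega))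
      rw [hia] at this ⊢
      linarith
    · rw [if_neg hia, zero_add]
      split_ifs with hki
      · rw [mul_comm]
        refine mul_le_mul_of_nonneg_left (le_trans ?_ (le_max_left _ _)) hpos
        have := except_ge k hk1 s (σ i) (s (σ a))
          ((Finset.univ.filter (fun i : Fin M => (i : ℕ) < k)).map σ.toEmbedding)
          (by simpa using hki) (by rw [Finset.card_map, card_lt _ (by omega)])
          (by
            intro m hm
            simp only [Finset.mem_map, Finset.mem_filter, Finset.mem_univ,
              true_and] at hm
            obtain ⟨j, hj, rfl⟩ := hm
            exact hmono j a (by rw [Fin.le_def]; simp [ha]; omega))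
        have h2 := hmono b i (by rw [Fin.le_def]; simpa [hb] using hki)
        linarith
      · rw [mul_zero]; positivity
  refine le_trans ?_ hR
  have hpa := hη.1 (σ a)
  rw [hEa] at hE
  have hH0 : 0 ≤ ∑ i : Fin M, (if k ≤ (i : ℕ) then η i else 0) :=
    Finset.sum_nonneg fun i _ => by split_ifs; exacts [hη.1 i, le_rfl]
  generalize ∑ i : Fin M, (if k ≤ (i : ℕ) then η (σ i) else 0) = H at *
  generalize ∑ i : Fin M, (if k ≤ (i : ℕ) then η i else 0) = H' at *
  generalize ∑ i : Fin M, (if k - 1 ≤ (i : ℕ) then η i else 0) = E' at *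
  rcases le_total d 1 with h1 | h1
  · rw [max_eq_left (by linarith)]
    have m1 := min_le_left (2 * H') E'
    have m2 := min_le_right (2 * H') E'
    nlinarith [mul_nonneg hd0 (show 0 ≤ 2 * H - min (2 * H') E' by linarith),
      mul_nonneg (sub_nonneg.2 h1) (show 0 ≤ η (σ a) + H - min (2 * H') E' by linarith)]
  · rw [max_eq_right (by linarith)]
    have m1 := min_le_left (2 * H') E'
    nlinarith

theorem upper_bound (M k : ℕ) (hk1 : 1 ≤ k) (hkM : k ≤ M - 1)
    (η : Fin M → ℝ) (hη : η ∈ Simplex M) (r : ℕ) (hr : r ≤ k) (c : ℝ) (hc0 : 0 ≤ c)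
    (hc : r = k ∧ c = 1 ∨ r < k ∧ c = 0) :
    condRisk (psi1 k) (fun i => if (i : ℕ) < r then (1 : ℝ) else 0) η ≤
      (1 + c) * ∑ i : Fin M, (if r ≤ (i : ℕ) then η i else 0) := by
  unfold condRisk
  rw [Finset.mul_sum]
  refine Finset.sum_le_sum fun i _ => ?_
  have hpos := hη.1 i
  have key : psi1 k (fun i : Fin M => if (i : ℕ) < r then (1 : ℝ) else 0) i ≤
      if r ≤ (i : ℕ) then 1 + c else 0 := by
    unfold psi1
    beta_reduce
    by_cases h1 : r ≤ (i : ℕ)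
    · rw [if_pos h1, if_neg (show ¬ ((i : ℕ) < r) by omega)]
      refine max_le ?_ (by linarith)
      have : kthLargestExcept (fun i : Fin M => if (i : ℕ) < r then (1 : ℝ) else 0) i k ≤ c := by
        rcases hc with ⟨_, rfl⟩ | ⟨hrk, rfl⟩
        · refine except_le k hk1 hkM _ i 1 (Finset.univ.erase i) (by simp) (by
            rw [Finset.card_erase_of_mem (by simp)]; simp; omega) ?_
          intro m _
          split_ifs <;> norm_num
        · refine except_le k hk1 hkM _ i 0
            ((Finset.univ.filter (fun i : Fin M => r ≤ (i : ℕ))).erase i) (by simp) (by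
            rw [Finset.card_erase_of_mem (by simpa using h1), card_ge]; omega) ?_
          intro m hm
          simp at hm
          rw [if_neg (by omega)]
      linarith
    · rw [if_neg h1, if_pos (show (i : ℕ) < r by omega)]
      refine max_le ?_ le_rfl
      have : kthLargestExcept (fun i : Fin M => if (i : ℕ) < r then (1 : ℝ) else 0) i k ≤ 0 := by
        refine except_le k hk1 hkM _ i 0
            (Finset.univ.filter (fun i : Fin M => r ≤ (i : ℕ))) (by simpa using h1) (by
            rw [card_ge]; omega) ?_
        intro m hm
        simp at hm
        rw [if_neg (by omega)]
      linarith
  refine (mul_le_mul_of_nonneg_left key hpos).trans (le_of_eq ?_)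
  split_ifs <;> ring

theorem stmt9 (M k : ℕ) (hM : 2 ≤ M) (hk1 : 1 ≤ k) (hkM : k ≤ M - 1)
    (η : Fin M → ℝ) (hη : η ∈ Simplex M)
    (hsorted : ∀ i j : Fin M, i ≤ j → η j ≤ η i) :
    -- (i)
    ((η ⟨k - 1, by omega⟩ ≥ ∑ i ∈ Finset.univ.filter (fun i : Fin M => k ≤ (i : ℕ)), η i) →
      (∀ s : Fin M → ℝ,
          condRisk (psi1 k) (fun i => if (i : ℕ) < k then (1 : ℝ) else 0) η ≤
            condRisk (psi1 k) s η) ∧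
        condRisk (psi1 k) (fun i => if (i : ℕ) < k then (1 : ℝ) else 0) η =
          2 * ∑ i ∈ Finset.univ.filter (fun i : Fin M => k ≤ (i : ℕ)), η i) ∧
    -- (ii)
    ((η ⟨k - 1, by omega⟩ ≤ ∑ i ∈ Finset.univ.filter (fun i : Fin M => k ≤ (i : ℕ)), η i) →
      (∀ s : Fin M → ℝ,
          condRisk (psi1 k) (fun i => if (i : ℕ) < k - 1 then (1 : ℝ) else 0) η ≤
            condRisk (psi1 k) s η) ∧
        condRisk (psi1 k) (fun i => if (i : ℕ) < k - 1 then (1 : ℝ) else 0) η =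
          ∑ i ∈ Finset.univ.filter (fun i : Fin M => k - 1 ≤ (i : ℕ)), η i) := by
  have hE : ∑ i : Fin M, (if k - 1 ≤ (i : ℕ) then η i else 0)
      = η ⟨k - 1, by omega⟩ + ∑ i : Fin M, (if k ≤ (i : ℕ) then η i else 0) := by
    have : ∀ i : Fin M, (if k - 1 ≤ (i : ℕ) then η i else 0)
      = (if i = (⟨k - 1, by omega⟩ : Fin M) then η i else 0)
        + (if k ≤ (i : ℕ) then η i else 0) := by
      intro i
      simp only [Fin.ext_iff]
      split_ifs <;> first | omega | simp
    rw [Finset.sum_congr rfl (fun i _ => this i), Finset.sum_add_distrib]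
    simp
  have hlow := lower_bound M k hM hk1 hkM η hη hsorted
  have hup1 := upper_bound M k hk1 hkM η hη k le_rfl 1 zero_le_one (Or.inl ⟨rfl, rfl⟩)
  have hup2 := upper_bound M k hk1 hkM η hη (k - 1) (by omega) 0 le_rfl
    (Or.inr ⟨by omega, rfl⟩)
  simp only [Finset.sum_filter]
  constructor
  · intro h
    rw [min_eq_left (by rw [hE]; linarith)] at hlow
    have h3 := hlow (fun i => if (i : ℕ) < k then (1 : ℝ) else 0)
    exact ⟨fun s => by have := hlow s; linarith, by linarith⟩
  · intro h
    rw [min_eq_right (by rw [hE]; linarith)] at hlow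
    have h3 := hlow (fun i => if (i : ℕ) < k - 1 then (1 : ℝ) else 0)
    exact ⟨fun s => by have := hlow s; linarith, by linarith⟩
end

section
/- Fix M ≥ 2 and k ∈ {1,…,M−1}, and consider the loss ψ2(s,y) := max{ (1/k) Σ_{i=1}^k (s + 1̄(y))_{[i]} − s_y, 0 }. If η ∈ Δ_M satisfies Σ_{m=k+1}^M η_{[m]} > k/(k+1), then the zero vector 0 ∈ ℝ^M is a global minimizer of s ↦ L_{ψ2}(s,η), and L_{ψ2}*(η) = L_{ψ2}(0,η) = 1. -/
open scoped BigOperators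
/-- `1̄(y)`: the vector with entry `1` everywhere except coordinate `y`, where it is `0`. -/
def onebar {M : ℕ} (y : Fin M) : Fin M → ℝ := fun i => if i = y then 0 else 1

/-- `ψ2(s,y) = max{(1/k) Σ_{i=1}^k (s + 1̄(y))_{[i]} − s_y, 0}` -/
noncomputable def psi2 {M : ℕ} (k : ℕ) (s : Fin M → ℝ) (y : Fin M) : ℝ :=
  max ((1 / (k : ℝ)) * ∑ i ∈ Finset.Icc 1 k, kthLargest (fun m => s m + onebar y m) i - s y) 0

/-- `ψ3(s,y) = (1/k) Σ_{i=1}^k max{(s + 1̄(y))_{[i]} − s_y, 0}` -/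
noncomputable def psi3 {M : ℕ} (k : ℕ) (s : Fin M → ℝ) (y : Fin M) : ℝ :=
  (1 / (k : ℝ)) * ∑ i ∈ Finset.Icc 1 k, max (kthLargest (fun m => s m + onebar y m) i - s y) 0

/-- `ψ4(s,y) = max{(1/k) Σ_{i=1}^k (1 + (s_{∖y})_{[i]}) − s_y, 0}` -/
noncomputable def psi4 {M : ℕ} (k : ℕ) (s : Fin M → ℝ) (y : Fin M) : ℝ :=
  max ((1 / (k : ℝ)) * ∑ i ∈ Finset.Icc 1 k, (1 + kthLargestExcept s y i) - s y) 0

lemma exists_sort {M : ℕ} (v : Fin M → ℝ) : ∃ σ : Equiv.Perm (Fin M),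
    (∀ i : Fin M, kthLargest v (i.val + 1) = v (σ i)) ∧ Antitone (v ∘ σ) := by
  classical
  have hanti : Antitone (v ∘ Tuple.sort (fun i => - v i)) := by
    intro i j hij
    have := Tuple.monotone_sort (fun i => - v i) hij
    simp only [Function.comp] at this ⊢
    linarith
  refine ⟨Tuple.sort (fun i => - v i), ?_, hanti⟩
  set σ := Tuple.sort (fun i => - v i)
  have hl : List.insertionSort (· ≥ ·) (List.ofFn v) = List.ofFn (v ∘ σ) := by
    apply List.Perm.eq_of_pairwise (le := (· ≥ ·))
    · intro a b _ _ h1 h2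
      exact le_antisymm h2 h1
    · exact List.pairwise_insertionSort _ _
    · rw [List.pairwise_ofFn]
      intro i j hij
      exact hanti hij.le
    · exact (List.perm_insertionSort _ _).trans (Equiv.Perm.ofFn_comp_perm σ v).symm
  intro i
  unfold kthLargest kthLargestList
  have : List.insertionSort (fun a b : ℝ => a ≥ b) (List.ofFn v) = List.ofFn (v ∘ σ) := by
    rw [← hl]
  convert_to (List.ofFn (v ∘ σ)).getD (i.val + 1 - 1) 0 = _
  · rw [← hl]
  · simp [List.getD_eq_getElem?_getD]

lemma sum_top (k : ℕ) (f : ℕ → ℝ) :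
    ∑ i ∈ Finset.Icc 1 k, f i = ∑ i ∈ Finset.range k, f (i + 1) := by
  rw [Finset.range_eq_Ico, Finset.sum_Ico_add' f 0 k 1]
  rfl

lemma sum_all {M : ℕ} (v : Fin M → ℝ) (h : ℝ → ℝ) :
    ∑ m, h (v m) = ∑ i ∈ Finset.range M, h (kthLargest v (i + 1)) := by
  obtain ⟨σ, h1, -⟩ := exists_sort v
  rw [Finset.sum_range (fun i => h (kthLargest v (i + 1)))]
  simp only [h1]
  exact (Equiv.sum_comp σ (fun m => h (v m))).symm

lemma kth_anti {M : ℕ} (v : Fin M → ℝ) {i j : ℕ} (hij : i ≤ j) (hj : j < M) :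
    kthLargest v (j + 1) ≤ kthLargest v (i + 1) := by
  obtain ⟨σ, h1, h2⟩ := exists_sort v
  have a := h1 ⟨j, hj⟩
  have b := h1 ⟨i, hij.trans_lt hj⟩
  simp only at a b
  rw [a, b]
  exact h2 hij

/-- excess over a threshold -/
lemma sum_pos_part {M : ℕ} (v : Fin M → ℝ) (k : ℕ) (hk : k ≤ M) (t : ℝ)
    (h1 : ∀ i < k, t ≤ kthLargest v (i + 1))
    (h2 : ∀ i, k ≤ i → i < M → kthLargest v (i + 1) ≤ t) :
    ∑ m, max (v m - t) 0 = ∑ i ∈ Finset.range k, kthLargest v (i + 1) - k * t := by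
  rw [sum_all v (fun x => max (x - t) 0)]
  rw [← Finset.sum_subset (Finset.range_subset_range.2 hk)]
  · rw [Finset.sum_congr rfl (g := fun i => kthLargest v (i + 1) - t)]
    · simp
    · intro i hi
      exact max_eq_left (by have := h1 i (Finset.mem_range.1 hi); linarith)
  · intro i hi hi'
    simp only [Finset.mem_range, not_lt] at hi hi'
    exact max_eq_right (by have := h2 i hi' hi; linarith)

lemma sum_le_top {M : ℕ} (v : Fin M → ℝ) (k : ℕ) (hk1 : 1 ≤ k) (hk : k ≤ M)
    (A : Finset (Fin M)) (hA : A.card = k) :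
    ∑ m ∈ A, v m ≤ ∑ i ∈ Finset.range k, kthLargest v (i + 1) := by
  obtain ⟨k, rfl⟩ : ∃ l, k = l + 1 := ⟨k - 1, by omega⟩
  have h := sum_pos_part v (k + 1) hk (kthLargest v (k + 1))
    (fun i hi => kth_anti v (by omega) (by omega))
    (fun i hi hi' => kth_anti v (by omega) (by omega))
  have h3 : ∑ m ∈ A, (v m - kthLargest v (k + 1)) ≤ ∑ m, max (v m - kthLargest v (k + 1)) 0 :=
    (Finset.sum_le_sum (fun m _ => le_max_left _ 0)).trans
      (Finset.sum_le_sum_of_subset_of_nonneg (Finset.subset_univ _)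
        (fun _ _ _ => le_max_right _ _))
  rw [Finset.sum_sub_distrib, Finset.sum_const, hA, nsmul_eq_mul] at h3
  linarith

lemma exists_set {M : ℕ} (s : Fin M → ℝ) (k : ℕ) (hk : k < M) (y : Fin M) :
    ∃ A : Finset (Fin M), A.card = k ∧ y ∉ A ∧
      k * kthLargest s (k + 1) + ∑ m, max (s m - kthLargest s (k + 1)) 0
        - max (s y - kthLargest s (k + 1)) 0 ≤ ∑ m ∈ A, s m := by
  classical
  obtain ⟨σ, h1, h2⟩ := exists_sort s
  have hx := sum_pos_part s k hk.le (kthLargest s (k + 1))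
    (fun i hi => kth_anti s (by omega) (by omega))
    (fun i hi hi' => kth_anti s (by omega) (by omega))
  have hsk := h1 ⟨k, hk⟩
  simp only at hsk
  set t := kthLargest s (k + 1)
  let B : Finset (Fin M) := (Finset.univ : Finset (Fin (k + 1))).map
    ((Fin.castLEEmb (by omega : k + 1 ≤ M)).trans σ.toEmbedding)
  have hBc : B.card = k + 1 := by simp [B]
  have hBs : ∑ m ∈ B, s m = ∑ i ∈ Finset.range k, kthLargest s (i + 1) + t := by
    rw [← Finset.sum_range_succ (fun i => kthLargest s (i + 1)), Finset.sum_range, Finset.sum_map]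
    refine Finset.sum_congr rfl fun i _ => ?_
    exact (h1 (Fin.castLE (by omega) i)).symm
  have hmem : ∀ i : Fin M, i.val ≤ k → σ i ∈ B := by
    intro i hi
    simp only [B, Finset.mem_map, Finset.mem_univ, true_and]
    exact ⟨⟨i.val, by omega⟩, rfl⟩
  by_cases hy : y ∈ B
  · refine ⟨B.erase y, by rw [Finset.card_erase_of_mem hy, hBc]; rfl, by simp, ?_⟩
    have := Finset.sum_erase_add B s hy
    have := le_max_left (s y - t) 0
    linarith
  · have hm := hmem ⟨k, hk⟩ le_rfl
    refine ⟨B.erase (σ ⟨k, hk⟩), by rw [Finset.card_erase_of_mem hm, hBc]; rfl,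
      fun h => hy (Finset.mem_of_mem_erase h), ?_⟩
    have := Finset.sum_erase_add B s hm
    have := le_max_right (s y - t) 0
    linarith

lemma sum_onebar {M : ℕ} (s : Fin M → ℝ) (y : Fin M) (A : Finset (Fin M)) (h : y ∉ A) :
    ∑ m ∈ A, (s m + onebar y m) = ∑ m ∈ A, s m + A.card := by
  rw [Finset.sum_add_distrib]
  congr 1
  rw [Finset.sum_congr rfl (g := fun _ => (1 : ℝ))]
  · simp
  · intro m hm
    simp only [onebar]
    rw [if_neg]
    rintro rfl
    exact h hm

lemma psi2_ge {M : ℕ} (s : Fin M → ℝ) (k : ℕ) (hk1 : 1 ≤ k) (hk : k < M) (y : Fin M) :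
    1 + (∑ m, max (s m - kthLargest s (k + 1)) 0) / k
      - max (s y - kthLargest s (k + 1)) 0 * ((k + 1) / k) ≤ psi2 k s y := by
  obtain ⟨A, hA, hyA, hle⟩ := exists_set s k hk y
  have h := sum_le_top (fun m => s m + onebar y m) k hk1 hk.le A hA
  rw [sum_onebar s y A hyA, hA] at h
  refine le_trans ?_ (le_max_left _ _)
  rw [sum_top]
  have hkp : (0 : ℝ) < k := by exact_mod_cast hk1
  have hm := le_max_left (s y - kthLargest s (k + 1)) 0
  generalize ∑ m, max (s m - kthLargest s (k + 1)) 0 = X at *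
  generalize max (s y - kthLargest s (k + 1)) 0 = x at *
  generalize kthLargest s (k + 1) = t at *
  generalize ∑ i ∈ Finset.range k, kthLargest (fun m => s m + onebar y m) (i + 1) = T at *
  have hT : (k * t + X - x + k) / k ≤ 1 / k * T := by
    rw [div_mul_eq_mul_div, one_mul]
    exact div_le_div_of_nonneg_right (by linarith) hkp.le
  have e1 : (k * t + X - x + k) / (k : ℝ) = t + X / k - x / k + 1 := by field_simp
  have e2 : x * (((k : ℝ) + 1) / k) = x + x / k := by field_simp
  rw [e2]
  linarith

lemma psi2_zero {M : ℕ} (k : ℕ) (hk1 : 1 ≤ k) (hk : k < M) (y : Fin M) :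
    psi2 k (fun _ => 0) y = 1 := by
  have hkp : (0 : ℝ) < k := by exact_mod_cast hk1
  have hub : ∑ i ∈ Finset.range k, kthLargest (fun m => (0 : ℝ) + onebar y m) (i + 1)
      ≤ (k : ℝ) := by
    have : ∀ i ∈ Finset.range k, kthLargest (fun m => (0 : ℝ) + onebar y m) (i + 1) ≤ 1 := by
      intro i hi
      obtain ⟨σ, h1, -⟩ := exists_sort (fun m => (0 : ℝ) + onebar y m)
      have := h1 ⟨i, by have := Finset.mem_range.1 hi; omega⟩
      simp only at this
      rw [this]
      simp only [onebar]
      split_ifs <;> norm_num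
    have := Finset.sum_le_sum this
    simpa using this
  obtain ⟨A, hA, hyA, -⟩ := exists_set (fun _ : Fin M => (0 : ℝ)) k hk y
  have hlb := sum_le_top (fun m => (0 : ℝ) + onebar y m) k hk1 hk.le A hA
  rw [sum_onebar (fun _ => 0) y A hyA, hA] at hlb
  simp only [Finset.sum_const_zero, zero_add] at hlb hub
  unfold psi2
  rw [sum_top]
  simp only [zero_add]
  rw [le_antisymm hub hlb, one_div_mul_cancel hkp.ne']
  norm_num

theorem stmt11 (M k : ℕ) (hM : 2 ≤ M) (hk1 : 1 ≤ k) (hkM : k ≤ M - 1)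
    (η : Fin M → ℝ) (hη : η ∈ Simplex M)
    (hbig : (k : ℝ) / (k + 1) < ∑ m ∈ Finset.Icc (k + 1) M, kthLargest η m) :
    (∀ s : Fin M → ℝ, condRisk (psi2 k) (fun _ => 0) η ≤ condRisk (psi2 k) s η) ∧
    sInf {L | ∃ s : Fin M → ℝ, L = condRisk (psi2 k) s η} =
      condRisk (psi2 k) (fun _ => 0) η ∧
    condRisk (psi2 k) (fun _ => (0 : ℝ)) η = 1 := by
  have hk : k < M := by omega
  have hkp : (0 : ℝ) < k := by exact_mod_cast hk1
  obtain ⟨hη0, hη1⟩ := hη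
  have hzero : condRisk (psi2 k) (fun _ => (0 : ℝ)) η = 1 := by
    unfold condRisk
    simp only [psi2_zero k hk1 hk, mul_one, hη1]
  have hsplit : ∑ i ∈ Finset.range k, kthLargest η (i + 1)
      + ∑ m ∈ Finset.Icc (k + 1) M, kthLargest η m = 1 := by
    have h1 := sum_all η (fun x => x)
    rw [hη1] at h1
    have h2 : ∑ m ∈ Finset.Icc (k + 1) M, kthLargest η m
        = ∑ i ∈ Finset.Ico k M, kthLargest η (i + 1) := by
      rw [Finset.sum_Ico_add' (kthLargest η) k M 1]
      rfl
    rw [h2, Finset.sum_range_add_sum_Ico _ hk.le, h1]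
  have hle : ∀ y, η y * (k + 1) ≤ 1 := by
    intro y
    obtain ⟨B, hyB, -, hB⟩ := Finset.exists_subsuperset_card_eq (s := {y})
      (t := (Finset.univ : Finset (Fin M))) (n := k) (Finset.subset_univ _) (by simpa using hk1)
      (by simpa using hk.le)
    have h1 := sum_le_top η k hk1 hk.le B hB
    have h2 := Finset.single_le_sum (f := η) (fun i _ => hη0 i) (Finset.singleton_subset_iff.1 hyB)
    have h3 : η y ≤ 1 - k / (k + 1) := by linarith
    have h4 : (1 : ℝ) - k / (k + 1) = 1 / (k + 1) := by field_simp; ring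
    rw [h4, le_div_iff₀ (by positivity)] at h3
    exact h3
  have hmain : ∀ s : Fin M → ℝ, 1 ≤ condRisk (psi2 k) s η := by
    intro s
    have h1 : ∀ y, η y * (1 + (∑ m, max (s m - kthLargest s (k + 1)) 0) / k)
        - max (s y - kthLargest s (k + 1)) 0 / k ≤ η y * psi2 k s y := by
      intro y
      refine le_trans ?_ (mul_le_mul_of_nonneg_left (psi2_ge s k hk1 hk y) (hη0 y))
      have hx := le_max_right (s y - kthLargest s (k + 1)) 0
      generalize max (s y - kthLargest s (k + 1)) 0 = x at *
      have h5 : (η y * (k + 1)) * (x / k) ≤ 1 * (x / k) :=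
        mul_le_mul_of_nonneg_right (hle y) (by positivity)
      have e : η y * (x * ((k + 1) / k)) = (η y * (k + 1)) * (x / k) := by ring
      rw [mul_sub, e]
      linarith
    have h2 := Finset.sum_le_sum (fun y (_ : y ∈ Finset.univ) => h1 y)
    rw [Finset.sum_sub_distrib, ← Finset.sum_mul, hη1, ← Finset.sum_div] at h2
    unfold condRisk
    linarith
  refine ⟨fun s => hzero ▸ hmain s, ?_, hzero⟩
  apply IsLeast.csInf_eq
  refine ⟨⟨_, rfl⟩, ?_⟩
  rintro L ⟨s, rfl⟩
  exact hzero ▸ hmain s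
end

section
/- Fix M ≥ 2 and k ∈ {1,…,M−1}, and consider the loss ψ3(s,y) := (1/k) Σ_{i=1}^k max{ (s + 1̄(y))_{[i]} − s_y, 0 }. If η ∈ Δ_M satisfies Σ_{m=k+1}^M η_{[m]} > k/(k+1), then the zero vector 0 ∈ ℝ^M is a global minimizer of s ↦ L_{ψ3}(s,η), and L_{ψ3}*(η) = L_{ψ3}(0,η) = 1. -/
open scoped BigOperators
theorem kth_perm {M : ℕ} (v : Fin M → ℝ) :
    ∃ σ : Equiv.Perm (Fin M), Antitone (v ∘ σ) ∧
      ∀ i : Fin M, kthLargest v (i.val + 1) = v (σ i) := by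
  classical
  obtain ⟨σ, hσ⟩ : ∃ σ : Equiv.Perm (Fin M), Antitone (v ∘ σ) := by
    refine ⟨Tuple.sort (fun i => - v i), ?_⟩
    intro a b hab
    have := Tuple.monotone_sort (fun i => - v i) hab
    simpa using this
  refine ⟨σ, hσ, ?_⟩
  have key : List.insertionSort (· ≥ ·) (List.ofFn v) = List.ofFn (v ∘ σ) := by
    apply List.Perm.eq_of_pairwise (le := fun a b : ℝ => a ≥ b)
    · intro a b _ _ h1 h2
      exact le_antisymm h2 h1
    · exact List.pairwise_insertionSort _ _
    · rw [List.pairwise_ofFn]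
      intro i j hij
      exact hσ hij.le
    · exact (List.perm_insertionSort _ _).trans (Equiv.Perm.ofFn_comp_perm σ v).symm
  intro i
  unfold kthLargest kthLargestList
  have key2 : ∀ inst : DecidableRel (fun a b : ℝ => a ≥ b),
      @List.insertionSort ℝ (fun a b => a ≥ b) inst (List.ofFn v) = List.ofFn (v ∘ σ) := by
    intro inst
    rw [← key]
    congr
  rw [key2]
  simp [List.getD]

theorem kth_top {M : ℕ} (v : Fin M → ℝ) (k : ℕ) (hk : k ≤ M) :
    ∃ T : Finset (Fin M), T.card = k ∧ (∀ i ∈ T, ∀ j ∉ T, v j ≤ v i) ∧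
      ∀ f : ℝ → ℝ, ∑ i ∈ Finset.Icc 1 k, f (kthLargest v i) = ∑ j ∈ T, f (v j) := by
  obtain ⟨σ, hσ, h⟩ := kth_perm v
  let e : Fin k ↪ Fin M := (Fin.castLEEmb hk).trans σ.toEmbedding
  refine ⟨Finset.univ.map e, by simp, ?_, ?_⟩
  · intro i hi j hj
    simp only [Finset.mem_map, Finset.mem_univ, true_and, not_exists] at hi hj
    obtain ⟨a, rfl⟩ := hi
    have hb : k ≤ (σ.symm j).val := by
      by_contra hlt
      push Not at hlt
      apply hj ⟨_, hlt⟩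
      simp [e]
    have := hσ (a := Fin.castLE hk a) (b := σ.symm j) (by
      rw [Fin.le_def]; simp; omega)
    simpa [e] using this
  · intro f
    rw [Finset.sum_map]
    have h1 : ∑ i ∈ Finset.Icc 1 k, f (kthLargest v i)
        = ∑ i ∈ Finset.range k, f (kthLargest v (i + 1)) := by
      rw [Finset.range_eq_Ico, Finset.sum_Ico_add' (fun i => f (kthLargest v i)) 0 k 1]
      rfl
    rw [h1, Finset.sum_range]
    refine Finset.sum_congr rfl fun i _ => ?_
    have := h (Fin.castLE hk i)
    simp only [Fin.val_castLE] at this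
    rw [this]
    rfl

theorem exchange {M : ℕ} (g : Fin M → ℝ) (S T : Finset (Fin M)) (hc : S.card = T.card)
    (hT : ∀ i ∈ T, ∀ j ∉ T, g j ≤ g i) : ∑ j ∈ S, g j ≤ ∑ j ∈ T, g j := by
  have hcard : (S \ T).card = (T \ S).card := Finset.card_sdiff_comm hc
  have h1 : ∑ j ∈ S \ T, g j ≤ ∑ j ∈ T \ S, g j := by
    rcases (S \ T).eq_empty_or_nonempty with h | h
    · have : T \ S = ∅ := by rw [← Finset.card_eq_zero, ← hcard, h]; simp
      rw [h, this]
    · obtain ⟨x, hx, hmax⟩ := Finset.exists_max_image (S \ T) g h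
      calc _ ≤ (S \ T).card • g x := Finset.sum_le_card_nsmul _ _ _ hmax
        _ = (T \ S).card • g x := by rw [hcard]
        _ ≤ _ := Finset.card_nsmul_le_sum _ _ _ (fun i hi =>
            hT i (Finset.mem_sdiff.1 hi).1 x (Finset.mem_sdiff.1 hx).2)
  have h2 := Finset.sum_inter_add_sum_sdiff S T g
  have h3 := Finset.sum_inter_add_sum_sdiff T S g
  rw [Finset.inter_comm] at h3
  linarith

theorem kth_sum_ge {M : ℕ} (v : Fin M → ℝ) (f : ℝ → ℝ) (hf : Monotone f)
    (S : Finset (Fin M)) :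
    ∑ j ∈ S, f (v j) ≤ ∑ i ∈ Finset.Icc 1 S.card, f (kthLargest v i) := by
  obtain ⟨T, hT, htop, hsum⟩ := kth_top v S.card (by simpa using S.card_le_univ)
  rw [hsum]
  exact exchange (fun j => f (v j)) S T hT.symm (fun i hi j hj => hf (htop i hi j hj))

theorem kth_tail_le {M : ℕ} (v : Fin M → ℝ) (S : Finset (Fin M)) :
    ∑ m ∈ Finset.Icc (S.card + 1) M, kthLargest v m ≤ ∑ j ∈ Sᶜ, v j := by
  have h1 := kth_sum_ge v id monotone_id S
  have hle : S.card ≤ M := by simpa using S.card_le_univ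
  obtain ⟨T, hT, -, hsum⟩ := kth_top v M le_rfl
  have hTu : T = Finset.univ := by rw [← Finset.card_eq_iff_eq_univ, hT]; simp
  have h2 := hsum id
  subst hTu
  have h3 := Finset.sum_add_sum_compl S v
  have h4 : ∑ i ∈ Finset.Icc 1 M, kthLargest v i = ∑ i ∈ Finset.Icc 1 S.card, kthLargest v i
      + ∑ m ∈ Finset.Icc (S.card + 1) M, kthLargest v m := by
    have := Finset.sum_Ico_consecutive (fun i => kthLargest v i)
      (m := 1) (n := S.card + 1) (k := M + 1) (by omega) (by omega)
    exact this.symm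
  simp only [id] at h1 h2
  linarith

theorem psi3_ge {M : ℕ} (s : Fin M → ℝ) (y : Fin M) (k : ℕ) (hk : 1 ≤ k)
    (S : Finset (Fin M)) (hS : S.card = k) (hy : y ∉ S) :
    1 + (∑ j ∈ S, s j) / k - s y ≤ psi3 k s y := by
  have h := kth_sum_ge (fun m => s m + onebar y m) (fun x => max (x - s y) 0)
    (fun a b hab => max_le_max (by linarith) le_rfl) S
  rw [hS] at h
  have h2 : ∑ j ∈ S, (s j + (1 - s y)) ≤ ∑ j ∈ S, max (s j + onebar y j - s y) 0 := by
    refine Finset.sum_le_sum fun j hj => le_max_of_le_left ?_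
    have : j ≠ y := fun e => hy (e ▸ hj)
    simp only [onebar, if_neg this]
    linarith
  rw [Finset.sum_add_distrib, Finset.sum_const, hS, nsmul_eq_mul] at h2
  have hk0 : (0 : ℝ) < k := by exact_mod_cast hk
  unfold psi3
  rw [one_div, inv_mul_eq_div, le_div_iff₀ hk0]
  refine le_trans (le_of_eq ?_) (h2.trans h)
  field_simp
  ring

theorem psi3_zero {M : ℕ} (y : Fin M) (k : ℕ) (hk : 1 ≤ k) (hkM : k ≤ M - 1) :
    psi3 k (fun _ => (0 : ℝ)) y = 1 := by
  have hk0 : (0 : ℝ) < k := by exact_mod_cast hk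
  apply le_antisymm
  · obtain ⟨T, hT, -, hsum⟩ := kth_top (fun m => (0 : ℝ) + onebar y m) k (by omega)
    have h := hsum (fun x => max (x - 0) 0)
    unfold psi3
    rw [h, one_div, inv_mul_eq_div, div_le_iff₀ hk0]
    refine (Finset.sum_le_card_nsmul T _ 1 ?_).trans (by simp [hT])
    intro j _
    unfold onebar
    split_ifs <;> norm_num
  · obtain ⟨S, hS, hc⟩ := Finset.exists_subset_card_eq (s := Finset.univ.erase y) (n := k) (by
      rw [Finset.card_erase_of_mem (Finset.mem_univ _)]; simpa using hkM)
    have := psi3_ge (fun _ => (0 : ℝ)) y k hk S hc (fun hy => by simpa using hS hy)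
    simpa using this

theorem stmt12 (M k : ℕ) (hM : 2 ≤ M) (hk1 : 1 ≤ k) (hkM : k ≤ M - 1)
    (η : Fin M → ℝ) (hη : η ∈ Simplex M)
    (hbig : (k : ℝ) / (k + 1) < ∑ m ∈ Finset.Icc (k + 1) M, kthLargest η m) :
    (∀ s : Fin M → ℝ, condRisk (psi3 k) (fun _ => 0) η ≤ condRisk (psi3 k) s η) ∧
    sInf {L | ∃ s : Fin M → ℝ, L = condRisk (psi3 k) s η} =
      condRisk (psi3 k) (fun _ => 0) η ∧
    condRisk (psi3 k) (fun _ => (0 : ℝ)) η = 1 := by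
  obtain ⟨hpos, hone⟩ := hη
  have hk0 : (0 : ℝ) < k := by exact_mod_cast hk1
  have hzero : condRisk (psi3 k) (fun _ => (0 : ℝ)) η = 1 := by
    unfold condRisk
    rw [← hone]
    exact Finset.sum_congr rfl fun y _ => by rw [psi3_zero y k hk1 hkM, mul_one]
  have hmin : ∀ s : Fin M → ℝ, 1 ≤ condRisk (psi3 k) s η := by
    intro s
    obtain ⟨T, hT, htop, -⟩ := kth_top s k (by omega)
    have hne : Tᶜ.Nonempty := by
      rw [← Finset.card_pos, Finset.card_compl, hT, Fintype.card_fin]; omega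
    obtain ⟨z, hz, hmax⟩ := Finset.exists_max_image Tᶜ s hne
    have hzT : z ∉ T := Finset.mem_compl.1 hz
    have hq := kth_tail_le η T
    rw [hT] at hq
    have hq2 := hbig.trans_le hq
    have hsplit := Finset.sum_add_sum_compl T η
    rw [hone] at hsplit
    set q := ∑ j ∈ Tᶜ, η j with hqdef
    have hqk : (k : ℝ) < q * (k + 1) := (div_lt_iff₀ (by positivity)).1 hq2
    have hw : ∀ j ∈ T, η j ≤ q / k := by
      intro j hj
      have h1 : η j ≤ ∑ i ∈ T, η i := Finset.single_le_sum (fun i _ => hpos i) hj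
      rw [le_div_iff₀ hk0]
      nlinarith
    have hA : ∀ y ∈ T, 1 + s z - s y ≤ psi3 k s y := by
      intro y hy
      have hc : (insert z (T.erase y)).card = k := by
        rw [Finset.card_insert_of_notMem (fun h => hzT (Finset.mem_of_mem_erase h)),
          Finset.card_erase_of_mem hy, hT]
        omega
      refine le_trans ?_ (psi3_ge s y k hk1 _ hc ?_)
      · have h2 : (k : ℝ) * s z ≤ ∑ j ∈ insert z (T.erase y), s j := by
          have := Finset.card_nsmul_le_sum (insert z (T.erase y)) s (s z) (by
            intro j hj
            rcases Finset.mem_insert.1 hj with rfl | hj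
            · exact le_rfl
            · exact htop j (Finset.mem_of_mem_erase hj) z hzT)
          rwa [hc, nsmul_eq_mul] at this
        have : s z ≤ (∑ j ∈ insert z (T.erase y), s j) / k := by
          rw [le_div_iff₀ hk0]; linarith
        linarith
      · simp only [Finset.mem_insert, Finset.mem_erase, not_or]
        exact ⟨fun e => hzT (e ▸ hy), fun h => h.1 rfl⟩
    have hB : ∀ y ∈ Tᶜ, 1 + (∑ j ∈ T, s j) / k - s z ≤ psi3 k s y := by
      intro y hy
      have := psi3_ge s y k hk1 T hT (Finset.mem_compl.1 hy)
      have := hmax y hy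
      linarith
    have e1 : ∑ y ∈ T, η y * (1 + s z - s y) ≤ ∑ y ∈ T, η y * psi3 k s y :=
      Finset.sum_le_sum fun y hy => mul_le_mul_of_nonneg_left (hA y hy) (hpos y)
    have e2 : ∑ y ∈ Tᶜ, η y * (1 + (∑ j ∈ T, s j) / k - s z) ≤ ∑ y ∈ Tᶜ, η y * psi3 k s y :=
      Finset.sum_le_sum fun y hy => mul_le_mul_of_nonneg_left (hB y hy) (hpos y)
    rw [← Finset.sum_mul, ← hqdef] at e2
    have e3 : ∑ y ∈ T, η y * (1 + s z - s y)
        = ∑ y ∈ T, η y - ∑ y ∈ T, η y * (s y - s z) := by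
      rw [← Finset.sum_sub_distrib]
      exact Finset.sum_congr rfl fun y _ => by ring
    have e4 : ∑ y ∈ T, η y * (s y - s z) ≤ ∑ y ∈ T, q / k * (s y - s z) :=
      Finset.sum_le_sum fun y hy =>
        mul_le_mul_of_nonneg_right (hw y hy) (sub_nonneg.2 (htop y hy z hzT))
    have e5 : ∑ y ∈ T, q / k * (s y - s z) = q * ((∑ j ∈ T, s j) / k - s z) := by
      rw [← Finset.mul_sum, Finset.sum_sub_distrib, Finset.sum_const, hT, nsmul_eq_mul]
      field_simp
    have e6 : condRisk (psi3 k) s η = _ :=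
      (Finset.sum_add_sum_compl T (fun y => η y * psi3 k s y)).symm
    rw [e6]
    linarith
  refine ⟨fun s => hzero ▸ hmin s, ?_, hzero⟩
  apply IsLeast.csInf_eq
  refine ⟨⟨_, rfl⟩, ?_⟩
  rintro L ⟨s, rfl⟩
  exact hzero ▸ hmin s
end

section
/- Fix M ≥ 2 and k ∈ {1,…,M−1}, and consider the loss ψ4(s,y) := max{ (1/k) Σ_{i=1}^k (1 + (s_{∖y})_{[i]}) − s_y, 0 }. If η ∈ Δ_M satisfies Σ_{m=k+1}^M η_{[m]} > k/(k+1), then the zero vector 0 ∈ ℝ^M is a global minimizer of s ↦ L_{ψ4}(s,η), and L_{ψ4}*(η) = L_{ψ4}(0,η) = 1. -/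
open scoped BigOperators
lemma sub_sum_le (L : List ℝ) (hL : L.Pairwise (· ≥ ·)) :
    ∀ w : List ℝ, w.Sublist L → w.sum ≤ (L.take w.length).sum := by
  induction L with
  | nil => intro w hw; simp [List.sublist_nil.1 hw]
  | cons a l ih =>
    intro w hw
    rw [List.pairwise_cons] at hL
    cases w with
    | nil => simp
    | cons b w =>
      have h2 : w.Sublist l := by
        have := hw.tail
        simpa using this
      have h1 : b ≤ a := by
        have : b ∈ a :: l := hw.subset (by simp)
        rcases List.mem_cons.1 this with h | h
        · exact h.le
        · exact hL.1 b h
      have := ih hL.2 w h2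
      simp only [List.sum_cons, List.length_cons, List.take_succ_cons]
      linarith

lemma sum_getD_take (L : List ℝ) (k : ℕ) :
    ∑ i ∈ Finset.Icc 1 k, L.getD (i - 1) 0 = (L.take k).sum := by
  induction k with
  | zero => simp
  | succ k ih =>
    rw [Finset.sum_Icc_succ_top (by omega), ih, Nat.add_sub_cancel]
    by_cases h : k < L.length
    · rw [List.sum_take_succ _ _ h, List.getD_eq_getElem _ _ h]
    · push Not at h
      rw [List.getD_eq_default _ _ h, List.take_of_length_le h, List.take_of_length_le (by omega)]
      simp

lemma topsum_ge (l w : List ℝ) (h : w.Subperm l) :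
    w.sum ≤ ∑ i ∈ Finset.Icc 1 w.length, kthLargestList l i := by
  unfold kthLargestList
  rw [sum_getD_take]
  have hp := List.perm_insertionSort (fun a b : ℝ => a ≥ b) l
  obtain ⟨w', hw', hs⟩ := h.trans hp.symm.subperm
  rw [← hw'.sum_eq, ← hw'.length_eq]
  exact sub_sum_le _ (List.pairwise_insertionSort _ _) _ hs

lemma except_perm {M : ℕ} (s : Fin M → ℝ) (y : Fin M) :
    (((List.ofFn s).eraseIdx y.val : List ℝ) : Multiset ℝ) = (Finset.univ.erase y).val.map s := by
  have h := List.getElem_cons_eraseIdx_perm (l := List.ofFn s) (n := y.val) (by simp)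
  have h1 := Multiset.coe_eq_coe.2 h
  have h2 : ((List.ofFn s : List ℝ) : Multiset ℝ) = Finset.univ.val.map s := by
    simp [List.ofFn_eq_map]
  have h3 : Finset.univ.val.map s = s y ::ₘ (Finset.univ.erase y).val.map s := by
    rw [← Multiset.map_cons, Finset.erase_val, Multiset.cons_erase (by simp)]
  rw [h2, h3] at h1
  rw [List.getElem_ofFn, ← Multiset.cons_coe] at h1
  exact (Multiset.cons_inj_right _).1 h1

lemma except_ge_s13 {M : ℕ} (s : Fin M → ℝ) (y : Fin M) (W : Finset (Fin M)) (hy : y ∉ W) :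
    ∑ u ∈ W, s u ≤ ∑ i ∈ Finset.Icc 1 W.card, kthLargestExcept s y i := by
  have h : (W.toList.map s).Subperm ((List.ofFn s).eraseIdx y.val) := by
    rw [← Multiset.coe_le, except_perm, ← Multiset.map_coe, Finset.coe_toList]
    apply Multiset.map_le_map
    rw [Finset.val_le_iff]
    intro u hu
    simp only [Finset.mem_erase, Finset.mem_univ, and_true]
    rintro rfl
    exact hy hu
  have := topsum_ge _ _ h
  simpa [kthLargestExcept] using this

lemma exists_top {M : ℕ} (s : Fin M → ℝ) (k : ℕ) (hk : k < M) :
    ∃ (U : Finset (Fin M)) (t : Fin M), U.card = k ∧ t ∉ U ∧ (∀ u ∈ U, s t ≤ s u) ∧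
      ∀ y ∉ U, s y ≤ s t := by
  have hm := Tuple.monotone_sort s
  set σ := Tuple.sort s
  let t0 : Fin M := ⟨M - k - 1, by omega⟩
  refine ⟨(Finset.Ioi t0).map σ.toEmbedding, σ t0, ?_, ?_, ?_, ?_⟩
  · simp [t0]; omega
  · simp
  · intro u hu
    simp only [Finset.mem_map, Finset.mem_Ioi] at hu
    obtain ⟨i, hi, rfl⟩ := hu
    exact hm hi.le
  · intro y hy
    obtain ⟨i, rfl⟩ := σ.surjective y
    have : i ≤ t0 := by
      by_contra h
      exact hy (by simpa using h)
    exact hm this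

lemma psi4_zero {M : ℕ} (k : ℕ) (hk : 1 ≤ k) (y : Fin M) :
    psi4 k (fun _ => (0 : ℝ)) y = 1 := by
  have h : ∀ i, kthLargestExcept (fun _ : Fin M => (0 : ℝ)) y i = 0 := by
    intro i
    unfold kthLargestExcept kthLargestList
    set l := (List.ofFn (fun _ : Fin M => (0 : ℝ))).eraseIdx y.val with hl
    by_cases h : i - 1 < (List.insertionSort (fun a b : ℝ => a ≥ b) l).length
    · rw [List.getD_eq_getElem _ _ h]
      have h1 := List.getElem_mem h
      rw [List.mem_insertionSort] at h1
      have h2 := List.mem_of_mem_eraseIdx h1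
      rw [List.mem_ofFn] at h2
      obtain ⟨_, h2⟩ := h2
      exact h2.symm
    · rw [List.getD_eq_default _ _ (by omega)]
  have hk' : (k : ℝ) ≠ 0 := by positivity
  simp [psi4, h, hk']

lemma eta_le {M : ℕ} (k : ℕ) (hk1 : 1 ≤ k) (hkM : k ≤ M) (η : Fin M → ℝ) (hη : η ∈ Simplex M)
    (hbig : (k : ℝ) / (k + 1) < ∑ m ∈ Finset.Icc (k + 1) M, kthLargest η m) (y : Fin M) :
    η y ≤ 1 / (k + 1) := by
  set L := List.insertionSort (fun a b : ℝ => a ≥ b) (List.ofFn η) with hL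
  have hp : L.Perm (List.ofFn η) := List.perm_insertionSort _ _
  have hlen : L.length = M := by rw [hp.length_eq]; simp
  have hnn : ∀ x ∈ L, 0 ≤ x := by
    intro x hx
    rw [hp.mem_iff, List.mem_ofFn] at hx
    obtain ⟨i, rfl⟩ := hx
    exact hη.1 i
  have hsum : L.sum = 1 := by rw [hp.sum_eq, List.sum_ofFn, hη.2]
  have hT : ∀ n, ∑ i ∈ Finset.Icc 1 n, kthLargest η i = (L.take n).sum := by
    intro n; exact sum_getD_take L n
  have hsplit : ∑ i ∈ Finset.Icc 1 k, kthLargest η i + ∑ m ∈ Finset.Icc (k + 1) M, kthLargest η m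
      = ∑ i ∈ Finset.Icc 1 M, kthLargest η i := by
    have := Finset.sum_Ioc_consecutive (fun i => kthLargest η i) (Nat.zero_le k) hkM
    have hI : ∀ a b : ℕ, Finset.Icc (a + 1) b = Finset.Ioc a b := by
      intro a b; ext x; simp only [Finset.mem_Icc, Finset.mem_Ioc]; omega
    rw [← hI, ← hI, ← hI] at this
    exact this
  rw [hT, hT, List.take_of_length_le (i := M) (by omega), hsum] at hsplit
  have hy : η y ∈ L := by rw [hp.mem_iff, List.mem_ofFn]; exact ⟨y, rfl⟩
  have h1 := sub_sum_le L (List.pairwise_insertionSort _ _) [η y] (List.singleton_sublist.2 hy)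
  have h2 : (L.take 1).sum ≤ (L.take k).sum := by
    apply List.Sublist.sum_le_sum
    · exact List.take_sublist_take_left hk1
    · intro x hx
      exact hnn x (List.mem_of_mem_take hx)
  simp only [List.sum_singleton, List.length_singleton] at h1
  have : (k : ℝ) / (k + 1) + 1 / (k + 1) = 1 := by field_simp
  linarith

lemma risk_ge {M : ℕ} (k : ℕ) (hk1 : 1 ≤ k) (hkM : k < M) (η : Fin M → ℝ) (hη : η ∈ Simplex M)
    (hle : ∀ y, η y ≤ 1 / ((k : ℝ) + 1)) (s : Fin M → ℝ) :
    1 ≤ condRisk (psi4 k) s η := by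
  obtain ⟨U, t, hU, ht, hge, hlt⟩ := exists_top s k hkM
  have hk0 : (0 : ℝ) < k := by exact_mod_cast hk1
  set E := ∑ u ∈ U, (s u - s t) with hE
  have hES : ∑ u ∈ U, s u = E + k * s t := by
    rw [hE, Finset.sum_sub_distrib]; simp [hU]
  have hpsi : ∀ y, ∀ W : Finset (Fin M), W.card = k → y ∉ W →
      1 + (∑ u ∈ W, s u) / k - s y ≤ psi4 k s y := by
    intro y W hW hy
    refine le_trans ?_ (le_max_left _ _)
    have h := except_ge_s13 s y W hy
    rw [hW] at h
    rw [Finset.sum_add_distrib]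
    simp only [Finset.sum_const, Nat.card_Icc, Nat.add_sub_cancel, nsmul_eq_mul, mul_one]
    rw [mul_add, one_div, inv_mul_cancel₀ hk0.ne', ← div_eq_inv_mul]
    have := div_le_div_of_nonneg_right h hk0.le
    linarith
  have hpt : ∀ y, 1 + E / k - (if y ∈ U then (s y - s t) * ((k + 1) / k) else 0) ≤ psi4 k s y := by
    intro y
    split_ifs with hy
    · have hte : t ∉ U.erase y := fun h => ht (Finset.mem_of_mem_erase h)
      have hyt : y ≠ t := by rintro rfl; exact ht hy
      have h := hpsi y (insert t (U.erase y))
        (by rw [Finset.card_insert_of_notMem hte, Finset.card_erase_of_mem hy]; omega)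
        (by simp [hyt])
      rw [Finset.sum_insert hte] at h
      have h3 := Finset.add_sum_erase U s hy
      have : ∑ x ∈ U.erase y, s x = E + k * s t - s y := by linarith
      rw [this] at h
      refine le_trans (le_of_eq ?_) h
      field_simp
      ring
    · have h := hpsi y U hU hy
      rw [hES, add_div, mul_div_cancel_left₀ _ hk0.ne'] at h
      have := hlt y hy
      linarith
  have hsum : ∑ y, η y * (1 + E / k - (if y ∈ U then (s y - s t) * ((k + 1) / k) else 0))
      ≤ condRisk (psi4 k) s η :=
    Finset.sum_le_sum fun y _ => mul_le_mul_of_nonneg_left (hpt y) (hη.1 y)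
  refine le_trans ?_ hsum
  simp only [mul_sub, Finset.sum_sub_distrib, ← Finset.sum_mul, hη.2, mul_ite, mul_zero]
  rw [Finset.sum_ite_mem, Finset.univ_inter]
  have : ∑ y ∈ U, η y * ((s y - s t) * ((k + 1) / k)) ≤ ∑ y ∈ U, (s y - s t) / k := by
    apply Finset.sum_le_sum
    intro y hy
    have h0 : 0 ≤ (s y - s t) * (((k : ℝ) + 1) / k) :=
      mul_nonneg (sub_nonneg.2 (hge y hy)) (by positivity)
    refine (mul_le_mul_of_nonneg_right (hle y) h0).trans (le_of_eq ?_)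
    field_simp
  rw [← Finset.sum_div, ← hE] at this
  simp only [mul_sub, Finset.sum_sub_distrib] at *
  linarith

theorem stmt13 (M k : ℕ) (hM : 2 ≤ M) (hk1 : 1 ≤ k) (hkM : k ≤ M - 1)
    (η : Fin M → ℝ) (hη : η ∈ Simplex M)
    (hbig : (k : ℝ) / (k + 1) < ∑ m ∈ Finset.Icc (k + 1) M, kthLargest η m) :
    (∀ s : Fin M → ℝ, condRisk (psi4 k) (fun _ => 0) η ≤ condRisk (psi4 k) s η) ∧
    sInf {L | ∃ s : Fin M → ℝ, L = condRisk (psi4 k) s η} =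
      condRisk (psi4 k) (fun _ => 0) η ∧
    condRisk (psi4 k) (fun _ => (0 : ℝ)) η = 1 := by
  have h0 : condRisk (psi4 k) (fun _ => (0 : ℝ)) η = 1 := by
    simp [condRisk, psi4_zero k hk1, hη.2]
  have h1 : ∀ s : Fin M → ℝ, condRisk (psi4 k) (fun _ => 0) η ≤ condRisk (psi4 k) s η := by
    intro s
    rw [h0]
    exact risk_ge k hk1 (by omega) η hη (eta_le k hk1 (by omega) η hη hbig) s
  refine ⟨h1, ?_, h0⟩
  apply IsLeast.csInf_eq
  refine ⟨⟨_, rfl⟩, ?_⟩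
  rintro _ ⟨s, rfl⟩
  exact h1 s
end

section
/- Let M = 11, k = 2, and η = (1/8, 1/8, 1/12, 1/12, 1/12, 1/12, 1/12, 1/12, 1/12, 1/12, 1/12) ∈ Δ_11. For each ψ ∈ {ψ2, ψ3, ψ4}, where ψ2(s,y) := max{(1/2) Σ_{i=1}^2 (s + 1̄(y))_{[i]} − s_y, 0}, ψ3(s,y) := (1/2) Σ_{i=1}^2 max{(s + 1̄(y))_{[i]} − s_y, 0}, and ψ4(s,y) := max{(1/2) Σ_{i=1}^2 (1 + (s_{∖y})_{[i]}) − s_y, 0}: the zero vector 0 ∈ ℝ^{11} is a global minimizer of s ↦ L_ψ(s,η), but 0 is not top-2 preserving with respect to η. Consequently, none of ψ2, ψ3, ψ4 is top-2 calibrated. -/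
open scoped BigOperators
/-- η = (1/8, 1/8, 1/12, …, 1/12) ∈ Δ₁₁ -/
noncomputable def etaEx : Fin 11 → ℝ := fun i => if (i : ℕ) < 2 then 1 / 8 else 1 / 12

lemma kth_pair_aux {l : List ℝ} (hs : l.Pairwise (· ≥ ·)) {u v : ℝ}
    (h : List.Sublist [u, v] l) : u + v ≤ l.getD 0 0 + l.getD 1 0 := by
  match l, hs, h with
  | [], _, h => simp at h
  | [a], _, h => simpa using h.length_le
  | a :: b :: t, hs, h =>
    simp only [List.pairwise_cons] at hs
    obtain ⟨h1, h2, -⟩ := hs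
    have hv : v ≤ b := by
      have : List.Sublist [v] (b :: t) := by
        simpa using h.tail
      rw [List.singleton_sublist] at this
      rcases List.mem_cons.1 this with rfl | hm
      · exact le_rfl
      · exact h2 _ hm
    have hu : u ≤ a := by
      have : u ∈ a :: b :: t := h.subset (by simp)
      rcases List.mem_cons.1 this with rfl | hm
      · exact le_rfl
      · exact h1 _ hm
    simp
    linarith

lemma kth_pair {l : List ℝ} {u v : ℝ} (h : List.Subperm [u, v] l) :
    u + v ≤ kthLargestList l 1 + kthLargestList l 2 := by
  classical
  have hp := h.trans (List.perm_insertionSort (· ≥ ·) l).symm.subperm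
  have hs : (List.insertionSort (· ≥ ·) l).Pairwise (· ≥ ·) :=
    List.pairwise_insertionSort (· ≥ ·) l
  obtain ⟨l', hl', hsub⟩ := hp
  have key : u + v ≤ (List.insertionSort (· ≥ ·) l).getD 0 0
      + (List.insertionSort (· ≥ ·) l).getD 1 0 := by
    have hcases : l' = [u, v] ∨ l' = [v, u] := by
      have hlen := hl'.length_eq
      match l', hlen with
      | [a, b], _ =>
        have ha : a = u ∨ a = v := by simpa using hl'.subset (List.mem_cons_self (a := a))
        rcases ha with rfl | rfl
        · left
          have := (List.perm_cons a).1 hl'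
          simpa using this
        · right
          have := (List.perm_cons a).1 (hl'.trans (List.Perm.swap _ _ []))
          simpa using this
    rcases hcases with rfl | rfl
    · exact kth_pair_aux hs hsub
    · have := kth_pair_aux hs hsub
      linarith
  unfold kthLargestList
  convert key using 3

lemma kth_mem (l : List ℝ) (j : ℕ) : kthLargestList l j = 0 ∨ kthLargestList l j ∈ l := by
  unfold kthLargestList
  rw [List.getD_eq_getElem?_getD]
  rcases h : (List.insertionSort (· ≥ ·) l)[j - 1]? with _ | x
  · simp
  · right
    have := List.mem_of_getElem? h
    rw [List.mem_insertionSort] at this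
    simpa using this

lemma kth_le {l : List ℝ} {c : ℝ} (hc : 0 ≤ c) (h : ∀ x ∈ l, x ≤ c) (j : ℕ) :
    kthLargestList l j ≤ c := by
  rcases kth_mem l j with h' | h'
  · rw [h']; exact hc
  · exact h _ h'

lemma le_kth {l : List ℝ} {c : ℝ} (hc : c ≤ 0) (h : ∀ x ∈ l, c ≤ x) (j : ℕ) :
    c ≤ kthLargestList l j := by
  rcases kth_mem l j with h' | h'
  · rw [h']; exact hc
  · exact h _ h'

lemma pair_ofFn (f : Fin 11 → ℝ) {i j : Fin 11} (hij : i ≠ j) :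
    List.Subperm [f i, f j] (List.ofFn f) := by
  rw [List.ofFn_eq_map]
  have : List.Subperm [i, j] (List.finRange 11) :=
    List.subperm_of_subset (by simpa using hij) (by intro x _; simp)
  obtain ⟨l', h1, h2⟩ := this
  exact ⟨l'.map f, h1.map f, h2.map f⟩

lemma pair_erase (f : Fin 11 → ℝ) {y i j : Fin 11} (hij : i ≠ j) (hi : i ≠ y) (hj : j ≠ y) :
    List.Subperm [f i, f j] ((List.ofFn f).eraseIdx y.val) := by
  rw [List.ofFn_eq_map, List.eraseIdx_map]
  have hm : ∀ x, x ≠ y → x ∈ (List.finRange 11).eraseIdx y.val := by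
    intro x hx
    rw [List.mem_eraseIdx_iff_getElem]
    refine ⟨x.val, by simp, ?_, by simp⟩
    exact fun h => hx (Fin.ext h)
  have : List.Subperm [i, j] ((List.finRange 11).eraseIdx y.val) :=
    List.subperm_of_subset (by simpa using hij) (by
      intro x hx
      simp at hx
      rcases hx with rfl | rfl
      · exact hm _ hi
      · exact hm _ hj)
  obtain ⟨l', h1, h2⟩ := this
  exact ⟨l'.map f, h1.map f, h2.map f⟩

lemma eta_sum (f : Fin 11 → ℝ) : ∑ m, etaEx m * f m =
    (f 0 + f 1) / 8 + (f 2 + f 3 + f 4 + f 5 + f 6 + f 7 + f 8 + f 9 + f 10) / 12 := by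
  simp [Fin.sum_univ_succ, etaEx, Fin.succ]
  ring_nf
  try rfl

lemma risk_lb (ψ : (Fin 11 → ℝ) → Fin 11 → ℝ) (s : Fin 11 → ℝ)
    (h : ∀ y i j : Fin 11, i ≠ j → i ≠ y → j ≠ y → 1 + (s i + s j) / 2 - s y ≤ ψ s y) :
    1 ≤ condRisk ψ s etaEx := by
  unfold condRisk
  rw [eta_sum]
  have a1 := h 2 0 1 (by decide) (by decide) (by decide)
  have a2 := h 3 0 1 (by decide) (by decide) (by decide)
  have a3 := h 4 0 1 (by decide) (by decide) (by decide)
  have a4 := h 5 2 3 (by decide) (by decide) (by decide)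
  have a5 := h 6 2 3 (by decide) (by decide) (by decide)
  have a6 := h 7 4 5 (by decide) (by decide) (by decide)
  have a7 := h 8 4 5 (by decide) (by decide) (by decide)
  have a8 := h 9 6 7 (by decide) (by decide) (by decide)
  have a9 := h 10 6 7 (by decide) (by decide) (by decide)
  have b1 := h 0 8 9 (by decide) (by decide) (by decide)
  have b2 := h 0 8 10 (by decide) (by decide) (by decide)
  have b3 := h 0 9 10 (by decide) (by decide) (by decide)
  have c1 := h 1 8 9 (by decide) (by decide) (by decide)
  have c2 := h 1 8 10 (by decide) (by decide) (by decide)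
  have c3 := h 1 9 10 (by decide) (by decide) (by decide)
  linarith

lemma risk_ub (ψ : (Fin 11 → ℝ) → Fin 11 → ℝ) (s : Fin 11 → ℝ)
    (h : ∀ y : Fin 11, ψ s y ≤ 1) : condRisk ψ s etaEx ≤ 1 := by
  unfold condRisk
  rw [eta_sum]
  linarith [h 0, h 1, h 2, h 3, h 4, h 5, h 6, h 7, h 8, h 9, h 10]

lemma Icc12 : Finset.Icc 1 2 = ({1, 2} : Finset ℕ) := by decide

lemma top2_bar (s : Fin 11 → ℝ) (y i j : Fin 11) (hij : i ≠ j) (hi : i ≠ y) (hj : j ≠ y) :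
    s i + 1 + (s j + 1) ≤ kthLargest (fun m => s m + onebar y m) 1
      + kthLargest (fun m => s m + onebar y m) 2 := by
  have := kth_pair (pair_ofFn (fun m => s m + onebar y m) hij)
  have ei : onebar y i = 1 := by simp [onebar, hi]
  have ej : onebar y j = 1 := by simp [onebar, hj]
  rw [ei, ej] at this
  exact this

lemma bar_le (y : Fin 11) (j : ℕ) :
    kthLargest (fun m : Fin 11 => (0 : ℝ) + onebar y m) j ≤ 1 := by
  apply kth_le zero_le_one
  intro x hx
  rw [List.mem_ofFn] at hx
  obtain ⟨m, rfl⟩ := hx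
  simp only [onebar]
  split_ifs <;> norm_num

lemma min2 (s : Fin 11 → ℝ) :
    condRisk (psi2 2) (fun _ => 0) etaEx ≤ condRisk (psi2 2) s etaEx := by
  refine (risk_ub _ _ fun y => ?_).trans (risk_lb _ _ fun y i j hij hi hj => ?_)
  · have h1 := bar_le y 1
    have h2 := bar_le y 2
    simp only [psi2, Icc12]
    rw [Finset.sum_pair (by decide)]
    refine max_le ?_ zero_le_one
    push_cast
    linarith
  · have := top2_bar s y i j hij hi hj
    simp only [psi2, Icc12]
    rw [Finset.sum_pair (by decide)]
    refine le_trans ?_ (le_max_left _ _)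
    push_cast
    linarith

lemma min3 (s : Fin 11 → ℝ) :
    condRisk (psi3 2) (fun _ => 0) etaEx ≤ condRisk (psi3 2) s etaEx := by
  refine (risk_ub _ _ fun y => ?_).trans (risk_lb _ _ fun y i j hij hi hj => ?_)
  · have h1 : max (kthLargest (fun m : Fin 11 => (0 : ℝ) + onebar y m) 1 - 0) 0 ≤ 1 :=
      max_le (by linarith [bar_le y 1]) zero_le_one
    have h2 : max (kthLargest (fun m : Fin 11 => (0 : ℝ) + onebar y m) 2 - 0) 0 ≤ 1 :=
      max_le (by linarith [bar_le y 2]) zero_le_one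
    simp only [psi3, Icc12]
    rw [Finset.sum_pair (by decide)]
    push_cast
    linarith
  · have := top2_bar s y i j hij hi hj
    simp only [psi3, Icc12]
    rw [Finset.sum_pair (by decide)]
    have h1 := le_max_left (kthLargest (fun m => s m + onebar y m) 1 - s y) 0
    have h2 := le_max_left (kthLargest (fun m => s m + onebar y m) 2 - s y) 0
    push_cast
    linarith

lemma except_le_s14 (y : Fin 11) (j : ℕ) :
    kthLargestExcept (fun _ : Fin 11 => (0 : ℝ)) y j ≤ 0 := by
  apply kth_le le_rfl
  intro x hx
  have := List.mem_of_mem_eraseIdx hx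
  rw [List.mem_ofFn] at this
  obtain ⟨m, rfl⟩ := this
  exact le_rfl

lemma min4 (s : Fin 11 → ℝ) :
    condRisk (psi4 2) (fun _ => 0) etaEx ≤ condRisk (psi4 2) s etaEx := by
  refine (risk_ub _ _ fun y => ?_).trans (risk_lb _ _ fun y i j hij hi hj => ?_)
  · have h1 := except_le_s14 y 1
    have h2 := except_le_s14 y 2
    simp only [psi4, Icc12]
    rw [Finset.sum_pair (by decide)]
    refine max_le ?_ zero_le_one
    push_cast
    linarith
  · have : s i + s j ≤ kthLargestExcept s y 1 + kthLargestExcept s y 2 :=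
      kth_pair (pair_erase s hij hi hj)
    simp only [psi4, Icc12]
    rw [Finset.sum_pair (by decide)]
    refine le_trans ?_ (le_max_left _ _)
    push_cast
    linarith

lemma eta_third : kthLargest etaEx 3 = 1 / 12 := by
  unfold kthLargest kthLargestList
  have hs : (List.ofFn etaEx).Pairwise (· ≥ ·) := by
    rw [List.pairwise_ofFn]
    intro i j hij
    have : i.val < j.val := hij
    simp only [etaEx]
    split_ifs <;> first | (exfalso; omega) | norm_num
  rw [hs.insertionSort_eq]
  simp [List.getD_eq_getElem?_getD, etaEx]

lemma not_pres : ¬ TopkPreserving 2 (fun _ : Fin 11 => (0 : ℝ)) etaEx := by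
  intro h
  have h1 := (h 0).1 (by
    rw [eta_third]
    norm_num [etaEx])
  have h2 : (0 : ℝ) ≤ kthLargest (fun _ : Fin 11 => (0 : ℝ)) (2 + 1) := by
    apply le_kth le_rfl
    intro x hx
    rw [List.mem_ofFn] at hx
    obtain ⟨m, rfl⟩ := hx
    exact le_rfl
  linarith

lemma eta_simplex : etaEx ∈ Simplex 11 := by
  refine ⟨fun m => ?_, ?_⟩
  · simp only [etaEx]
    split_ifs <;> norm_num
  · have := eta_sum (fun _ => 1)
    simp only [mul_one] at this
    rw [this]
    norm_num

lemma not_cal (ψ : (Fin 11 → ℝ) → Fin 11 → ℝ)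
    (h : ∀ s, condRisk ψ (fun _ => 0) etaEx ≤ condRisk ψ s etaEx) :
    ¬ TopkCalibrated 11 2 ψ := by
  intro hc
  have := hc etaEx eta_simplex
  have h1 : sInf {L | ∃ s, ¬ TopkPreserving 2 s etaEx ∧ L = condRisk ψ s etaEx}
      ≤ condRisk ψ (fun _ => 0) etaEx :=
    csInf_le ⟨condRisk ψ (fun _ => 0) etaEx, by rintro _ ⟨s, -, rfl⟩; exact h s⟩
      ⟨_, not_pres, rfl⟩
  have h2 : condRisk ψ (fun _ => 0) etaEx ≤ sInf {L | ∃ s, L = condRisk ψ s etaEx} :=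
    le_csInf ⟨_, (fun _ => 0), rfl⟩ (by rintro _ ⟨s, rfl⟩; exact h s)
  linarith

theorem stmt14 :
    etaEx ∈ Simplex 11 ∧
    ((∀ s : Fin 11 → ℝ, condRisk (psi2 2) (fun _ => 0) etaEx ≤ condRisk (psi2 2) s etaEx) ∧
      (∀ s : Fin 11 → ℝ, condRisk (psi3 2) (fun _ => 0) etaEx ≤ condRisk (psi3 2) s etaEx) ∧
      (∀ s : Fin 11 → ℝ, condRisk (psi4 2) (fun _ => 0) etaEx ≤ condRisk (psi4 2) s etaEx)) ∧
    ¬ TopkPreserving 2 (fun _ => (0 : ℝ)) etaEx ∧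
    (¬ TopkCalibrated 11 2 (psi2 2) ∧ ¬ TopkCalibrated 11 2 (psi3 2) ∧
      ¬ TopkCalibrated 11 2 (psi4 2)) := by
  exact ⟨eta_simplex, ⟨min2, min3, min4⟩, not_pres, not_cal _ min2, not_cal _ min3, not_cal _ min4⟩
end

section
/- Let d ≥ 1, M ≥ 2, k ∈ {1,…,M−1}, and let (x_1,y_1),…,(x_n,y_n) ∈ ℝ^d × {1,…,M} be a finite dataset that is linearly top-k separable, i.e. there exists W ∈ ℝ^{M×d} with (Wx_i)_{y_i} > (Wx_i)_{[k+1]} for every i ∈ {1,…,n}. Then: (i) there exists W' ∈ ℝ^{M×d} (namely W' = CW for C ≥ 1/δ, where δ := min_i ((Wx_i)_{y_i} − (Wx_i)_{[k+1]}) > 0) such that ψ1(W'x_i, y_i) = 0 and ψ5(W'x_i, y_i) = 0 for every i; and (ii) for ψ ∈ {ψ1, ψ5}, any W'' ∈ ℝ^{M×d} minimizing the empirical risk (1/n) Σ_{i=1}^n ψ(W''x_i, y_i) over ℝ^{M×d} achieves zero empirical risk, and hence satisfies (W''x_i)_{y_i} > (W''x_i)_{[k+1]} for every i, i.e. W'' is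 a top-k linear separator for the dataset. Here ψ1(s,y) := max{1 + (s_{∖y})_{[k]} − s_y, 0} and ψ5(s,y) := max{1 + s_{[k+1]} − s_y, 0}. -/
open scoped BigOperators
/-- `ψ5(s,y) = max{1 + s_{[k+1]} − s_y, 0}` -/
noncomputable def psi5 {M : ℕ} (k : ℕ) (s : Fin M → ℝ) (y : Fin M) : ℝ :=
  max (1 + kthLargest s (k + 1) - s y) 0

theorem aux_insert [DecidableRel ((· ≥ ·) : ℝ → ℝ → Prop)] (a : ℝ) (l : List ℝ)
    (hl : l.Pairwise (· ≥ ·)) : ∀ j, j < l.length →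
    (l.getD j 0 < a → (l.orderedInsert (· ≥ ·) a).getD (j + 1) 0 = l.getD j 0) ∧
    (a ≤ l.getD j 0 → a ≤ (l.orderedInsert (· ≥ ·) a).getD (j + 1) 0) := by
  induction l with
  | nil => intro j hj; simp at hj
  | cons b l ih =>
    intro j hj
    rw [List.orderedInsert_cons]
    split_ifs with h
    · simp
    · have hab : a < b := not_le.mp h
      cases j with
      | zero =>
        refine ⟨fun h1 => absurd h1 (by simpa using hab.le), fun _ => ?_⟩
        cases l with
        | nil => simp
        | cons c l =>
          rw [List.orderedInsert_cons]
          split_ifs with h2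
          · simp
          · simpa using (not_le.mp h2).le
      | succ j =>
        have := ih (List.pairwise_cons.mp hl).2 j (by simpa using hj)
        simpa using this

theorem aux_rel {M : ℕ} (s : Fin M → ℝ) (y : Fin M) (k : ℕ) (hk1 : 1 ≤ k) (hkM : k ≤ M - 1) :
    (kthLargestExcept s y k < s y → kthLargest s (k + 1) = kthLargestExcept s y k) ∧
    (s y ≤ kthLargestExcept s y k → s y ≤ kthLargest s (k + 1)) := by
  classical
  obtain ⟨j, rfl⟩ : ∃ j, k = j + 1 := ⟨k - 1, by omega⟩
  have hy := y.isLt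
  have hlen : y.val < (List.ofFn s).length := by simp
  have hp := List.getElem_cons_eraseIdx_perm hlen
  simp only [List.getElem_ofFn] at hp
  unfold kthLargest kthLargestExcept kthLargestList
  have hs : List.insertionSort (· ≥ ·) (List.ofFn s) =
      List.orderedInsert (· ≥ ·) (s y)
        (List.insertionSort (· ≥ ·) ((List.ofFn s).eraseIdx y.val)) := by
    rw [← List.insertionSort_cons]
    refine List.Perm.eq_of_pairwise' (List.pairwise_insertionSort (· ≥ ·) _)
      (List.pairwise_insertionSort (· ≥ ·) _) ?_
    exact (List.perm_insertionSort _ _).trans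
      (hp.symm.trans (List.perm_insertionSort _ _).symm)
  have := aux_insert (s y) (List.insertionSort (· ≥ ·) ((List.ofFn s).eraseIdx y.val))
    (List.pairwise_insertionSort (· ≥ ·) _) j (by
      rw [List.length_insertionSort, List.length_eraseIdx_of_lt hlen, List.length_ofFn]; omega)
  rw [← hs] at this
  simp only [Nat.add_sub_cancel]
  convert this

theorem aux_scale {M : ℕ} (s : Fin M → ℝ) (C : ℝ) (hC : 0 < C) (j : ℕ) :
    kthLargest (C • s) j = C * kthLargest s j := by
  classical
  unfold kthLargest kthLargestList
  have h := List.map_insertionSort (r := (· ≥ ·)) (s := (· ≥ ·)) (fun t : ℝ => C * t)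
    (List.ofFn s) (by intro a _ b _; simp [hC])
  rw [List.map_ofFn] at h
  have e : (fun t : ℝ => C * t) ∘ s = C • s := by ext; simp
  rw [e] at h
  have g := List.getD_map (l := List.insertionSort (· ≥ ·) (List.ofFn s)) (n := j - 1) (d := (0:ℝ))
    (f := fun t : ℝ => C * t)
  rw [h] at g
  simp only [mul_zero] at g
  convert g using 2

theorem psi5_zero {M : ℕ} (k : ℕ) (s : Fin M → ℝ) (y : Fin M) :
    psi5 k s y = 0 ↔ 1 + kthLargest s (k + 1) ≤ s y := by
  unfold psi5; rw [max_eq_right_iff, sub_nonpos]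

theorem psi_iff {M : ℕ} (s : Fin M → ℝ) (y : Fin M) (k : ℕ) (hk1 : 1 ≤ k) (hkM : k ≤ M - 1) :
    psi1 k s y = 0 ↔ psi5 k s y = 0 := by
  rw [psi5_zero]
  unfold psi1; rw [max_eq_right_iff, sub_nonpos]
  obtain ⟨h1, h2⟩ := aux_rel s y k hk1 hkM
  rcases lt_or_ge (kthLargestExcept s y k) (s y) with h | h
  · rw [h1 h]
  · have := h2 h
    constructor <;> intro <;> linarith

theorem aux_min {n : ℕ} {A : Type*} (f : A → Fin n → ℝ) (hf : ∀ W i, 0 ≤ f W i) (W' W'' : A)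
    (h0 : ∀ i, f W' i = 0)
    (hm : (1 / (n : ℝ)) * ∑ i, f W'' i ≤ (1 / (n : ℝ)) * ∑ i, f W' i) :
    (1 / (n : ℝ)) * ∑ i, f W'' i = 0 ∧ ∀ i, f W'' i = 0 := by
  have hs : 0 ≤ ∑ i, f W'' i := Finset.sum_nonneg fun i _ => hf _ i
  have hz : (1 / (n : ℝ)) * ∑ i, f W'' i = 0 := by
    refine le_antisymm (by simpa [h0] using hm) (by positivity)
  refine ⟨hz, fun i => ?_⟩
  have hn : (n : ℝ) ≠ 0 := by
    have := i.pos
    positivity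
  have : ∑ i, f W'' i = 0 := by
    rcases mul_eq_zero.mp hz with h | h
    · exact absurd h (by simpa using hn)
    · exact h
  exact (Finset.sum_eq_zero_iff_of_nonneg fun i _ => hf _ i).mp this i (Finset.mem_univ i)

theorem stmt17 (d M : ℕ) (hd : 1 ≤ d) (hM : 2 ≤ M) (k : ℕ) (hk1 : 1 ≤ k) (hkM : k ≤ M - 1)
    (n : ℕ) (x : Fin n → (Fin d → ℝ)) (y : Fin n → Fin M)
    (hsep : ∃ W : Matrix (Fin M) (Fin d) ℝ,
      ∀ i, kthLargest (W.mulVec (x i)) (k + 1) < (W.mulVec (x i)) (y i)) :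
    -- (i)
    (∃ W' : Matrix (Fin M) (Fin d) ℝ,
      ∀ i, psi1 k (W'.mulVec (x i)) (y i) = 0 ∧ psi5 k (W'.mulVec (x i)) (y i) = 0) ∧
    -- (ii) for ψ1
    (∀ W'' : Matrix (Fin M) (Fin d) ℝ,
      (∀ W : Matrix (Fin M) (Fin d) ℝ,
        (1 / (n : ℝ)) * ∑ i, psi1 k (W''.mulVec (x i)) (y i) ≤
          (1 / (n : ℝ)) * ∑ i, psi1 k (W.mulVec (x i)) (y i)) →
      (1 / (n : ℝ)) * ∑ i, psi1 k (W''.mulVec (x i)) (y i) = 0 ∧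
        ∀ i, kthLargest (W''.mulVec (x i)) (k + 1) < (W''.mulVec (x i)) (y i)) ∧
    -- (ii) for ψ5
    (∀ W'' : Matrix (Fin M) (Fin d) ℝ,
      (∀ W : Matrix (Fin M) (Fin d) ℝ,
        (1 / (n : ℝ)) * ∑ i, psi5 k (W''.mulVec (x i)) (y i) ≤
          (1 / (n : ℝ)) * ∑ i, psi5 k (W.mulVec (x i)) (y i)) →
      (1 / (n : ℝ)) * ∑ i, psi5 k (W''.mulVec (x i)) (y i) = 0 ∧
        ∀ i, kthLargest (W''.mulVec (x i)) (k + 1) < (W''.mulVec (x i)) (y i)) := by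
  obtain ⟨W, hW⟩ := hsep
  have hi : ∃ W' : Matrix (Fin M) (Fin d) ℝ,
      ∀ i, psi1 k (W'.mulVec (x i)) (y i) = 0 ∧ psi5 k (W'.mulVec (x i)) (y i) = 0 := by
    let δ : Fin n → ℝ := fun i => W.mulVec (x i) (y i) - kthLargest (W.mulVec (x i)) (k + 1)
    have hδ : ∀ i, 0 < δ i := fun i => sub_pos.mpr (hW i)
    have hnn : ∀ i, 0 ≤ 1 / δ i := fun i => (one_div_pos.mpr (hδ i)).le
    have hsum : 0 ≤ ∑ i, 1 / δ i := Finset.sum_nonneg fun i _ => hnn i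
    refine ⟨(1 + ∑ i, 1 / δ i) • W, fun i => ?_⟩
    rw [psi_iff _ _ k hk1 hkM, and_self, psi5_zero, Matrix.smul_mulVec,
      aux_scale _ _ (by linarith)]
    have h1 : 1 / δ i ≤ 1 + ∑ i, 1 / δ i := by
      have := Finset.single_le_sum (f := fun i => 1 / δ i) (fun i _ => hnn i) (Finset.mem_univ i)
      linarith
    have h2 := (div_le_iff₀ (hδ i)).mp h1
    simp only [Pi.smul_apply, smul_eq_mul]
    have h3 : δ i = W.mulVec (x i) (y i) - kthLargest (W.mulVec (x i)) (k + 1) := rfl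
    rw [h3, mul_sub] at h2
    linarith
  refine ⟨hi, ?_, ?_⟩
  · obtain ⟨W', hW'⟩ := hi
    intro W'' hm
    obtain ⟨h1, h2⟩ := aux_min (fun (V : Matrix (Fin M) (Fin d) ℝ) i => psi1 k (V.mulVec (x i)) (y i))
      (fun _ _ => le_max_right _ _) W' W'' (fun i => (hW' i).1) (hm W')
    refine ⟨h1, fun i => ?_⟩
    have := (psi5_zero _ _ _).mp ((psi_iff _ _ k hk1 hkM).mp (h2 i))
    linarith
  · obtain ⟨W', hW'⟩ := hi
    intro W'' hm
    obtain ⟨h1, h2⟩ := aux_min (fun (V : Matrix (Fin M) (Fin d) ℝ) i => psi5 k (V.mulVec (x i)) (y i))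
      (fun _ _ => le_max_right _ _) W' W'' (fun i => (hW' i).2) (hm W')
    refine ⟨h1, fun i => ?_⟩
    have := (psi5_zero _ _ _).mp (h2 i)
    linarith
end

section
/- Fix M ≥ 2 and define Ψ^{CD}(s,y) := log(1 + exp(−s_y)) + Σ_{i≠y} ( s_i − (1/(M−1)) Σ_{j≠y} s_j )² + Σ_{i≠y} s_i² for s ∈ ℝ^M and y ∈ {1,…,M}. Let s ∈ ℝ^M with s_m ≥ 0 for all m, and let i, j ∈ {1,…,M} be indices such that s_i ≥ s_m for all m ∈ {1,…,M} and s_j < s_i. Then Ψ^{CD}(s,j) > Ψ^{CD}(s,i). (In particular, any minimizer of η ↦ Σ_m η_m Ψ^{CD}(s,m)-type conditional risks assigns its strictly largest score to a most probable class, which underlies the top-1 calibration of Ψ^{CD}.) -/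
open scoped BigOperators
/-- `Ψ^{CD}(s,y) = log(1 + e^{−s_y}) + Σ_{i≠y} (s_i − (1/(M−1)) Σ_{j≠y} s_j)² + Σ_{i≠y} s_i²` -/
noncomputable def PsiCD {M : ℕ} (s : Fin M → ℝ) (y : Fin M) : ℝ :=
  Real.log (1 + Real.exp (-(s y))) +
    ∑ i ∈ Finset.univ.erase y,
      (s i - (1 / ((M : ℝ) - 1)) * ∑ j ∈ Finset.univ.erase y, s j) ^ 2 +
    ∑ i ∈ Finset.univ.erase y, (s i) ^ 2

lemma PsiCD_closed {M : ℕ} (hM : 2 ≤ M) (s : Fin M → ℝ) (y : Fin M) :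
    PsiCD s y = Real.log (1 + Real.exp (-(s y))) + 2 * (∑ k, s k ^ 2 - s y ^ 2)
      - (∑ k, s k - s y) ^ 2 / ((M : ℝ) - 1) := by
  have hM' : (2 : ℝ) ≤ M := by exact_mod_cast hM
  have hn : (M : ℝ) - 1 ≠ 0 := by linarith
  have hc : (((Finset.univ.erase y).card : ℕ) : ℝ) = (M : ℝ) - 1 := by
    rw [Finset.card_erase_of_mem (Finset.mem_univ y), Finset.card_univ, Fintype.card_fin,
      Nat.cast_sub (by omega)]
    simp
  have h1 : ∑ k, s k = ∑ k ∈ Finset.univ.erase y, s k + s y :=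
    (Finset.sum_erase_add _ _ (Finset.mem_univ y)).symm
  have h2 : ∑ k, s k ^ 2 = ∑ k ∈ Finset.univ.erase y, s k ^ 2 + s y ^ 2 :=
    (Finset.sum_erase_add _ (fun k => s k ^ 2) (Finset.mem_univ y)).symm
  have h3 : ∀ c : ℝ, ∑ k ∈ Finset.univ.erase y, (s k - c) ^ 2
      = ∑ k ∈ Finset.univ.erase y, s k ^ 2 - 2 * c * ∑ k ∈ Finset.univ.erase y, s k
        + ((M : ℝ) - 1) * c ^ 2 := by
    intro c
    rw [← hc, Finset.mul_sum, ← nsmul_eq_mul, ← Finset.sum_const, ← Finset.sum_sub_distrib,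
      ← Finset.sum_add_distrib]
    exact Finset.sum_congr rfl fun k _ => by ring
  unfold PsiCD
  rw [h3, h1, h2]
  field_simp
  ring

theorem stmt19 (M : ℕ) (hM : 2 ≤ M) (s : Fin M → ℝ)
    (hnn : ∀ m, 0 ≤ s m)
    (i j : Fin M) (hmax : ∀ m, s m ≤ s i) (hlt : s j < s i) :
    PsiCD s i < PsiCD s j := by
  have hM' : (2 : ℝ) ≤ M := by exact_mod_cast hM
  have hn : (0 : ℝ) < (M : ℝ) - 1 := by linarith
  rw [PsiCD_closed hM, PsiCD_closed hM]
  have hlog : Real.log (1 + Real.exp (-(s i))) < Real.log (1 + Real.exp (-(s j))) := by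
    apply Real.log_lt_log (by positivity)
    have := Real.exp_lt_exp.mpr (neg_lt_neg hlt)
    linarith
  have hT : ∑ k, s k ≤ ((M : ℝ) - 1) * s i + s j := by
    rw [← Finset.sum_erase_add _ _ (Finset.mem_univ j)]
    have h := Finset.sum_le_card_nsmul (Finset.univ.erase j) s (s i) (fun m _ => hmax m)
    rw [Finset.card_erase_of_mem (Finset.mem_univ j), Finset.card_univ, Fintype.card_fin,
      nsmul_eq_mul, Nat.cast_sub (by omega), Nat.cast_one] at h
    linarith
  have hj := hnn j
  have key : ((∑ k, s k - s j) ^ 2 - (∑ k, s k - s i) ^ 2) / ((M : ℝ) - 1)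
      ≤ 2 * (s i ^ 2 - s j ^ 2) := by
    rw [div_le_iff₀ hn]
    have hb : 0 ≤ ((M : ℝ) - 1) * s j := mul_nonneg hn.le hj
    have h : 0 ≤ (s i - s j) *
        (2 * (s i + s j) * ((M : ℝ) - 1) - (2 * ∑ k, s k - s i - s j)) :=
      mul_nonneg (by linarith) (by linarith)
    nlinarith [h]
  rw [sub_div] at key
  linarith
end
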